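/- Assume D is lenticular (γ₁ convex and γ₂ concave on I) and ζ < (√721 − 25)/48, and let u : D̄ → ℝ be the Lipschitz function with S_u = R_φ and u = φ on ∂D. Then u is a stationary point of the intrinsic area: for every w ∈ C^∞_c(D), the function ε ↦ A_H(u + εw) = ∫_D √(1 + (B(u+εw))²) dy dt is differentiable at ε = 0 and its derivative there is 0; moreover A_H(u) ≤ A_H(u + εw) for all sufficiently small |ε|. -/

import Mathlib

open Set MeasureTheory

noncomputable section

/-- `Q_φ(s,λ) = λ - s + 2(γ₂(λ) - γ₁(s))(φ₂(λ) + φ₁(s))` from the paper. -/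
def Qphi (γ₁ γ₂ φ₁ φ₂ : ℝ → ℝ) (s l : ℝ) : ℝ :=
  l - s + 2 * (γ₂ l - γ₁ s) * (φ₂ l + φ₁ s)

/-- The boundary curve `p(s) = (φ(s), γ(s), s + 2γ(s)φ(s))` in `ℝ³ ≅ ℍ`. -/
def heisP (γ φ : ℝ → ℝ) (s : ℝ) : ℝ × ℝ × ℝ :=
  (φ s, γ s, s + 2 * γ s * φ s)

/-- The ruled parametrization `ρ(h,s) = (1-h)·p₁(s) + h·p₂(λ(s))`. -/
def heisRho (γ₁ γ₂ φ₁ φ₂ lam : ℝ → ℝ) (w : ℝ × ℝ) : ℝ × ℝ × ℝ :=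
  (1 - w.1) • heisP γ₁ φ₁ w.2 + w.1 • heisP γ₂ φ₂ (lam w.2)

/-- The lenticular domain `D = {(y,t) : t ∈ (0,t̄), γ₁(t) < y < γ₂(t)}`. -/
def lensD (γ₁ γ₂ : ℝ → ℝ) (tb : ℝ) : Set (ℝ × ℝ) :=
  {w | w.2 ∈ Set.Ioo 0 tb ∧ γ₁ w.2 < w.1 ∧ w.1 < γ₂ w.2}

section

open Filter Topology

section LocallyLipschitz

variable {α E F : Type*} [PseudoMetricSpace α] [NormedAddCommGroup E] [NormedSpace ℝ E]
  [NormedAddCommGroup F] [NormedSpace ℝ F]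

/-- Postcomposing a locally Lipschitz map with a `C¹` map gives a locally Lipschitz map. -/
lemma locallyLipschitzOn_contDiffAt_comp {D : Set α} {f : α → E} {G : E → F}
    (hf : LocallyLipschitzOn D f) (hG : ∀ p ∈ D, ContDiffAt ℝ 1 G (f p)) :
    LocallyLipschitzOn D (fun p => G (f p)) := by
  intro p hp
  obtain ⟨K, t, ht, hK⟩ := hf hp
  obtain ⟨C, s, hs, hC⟩ := (hG p hp).exists_lipschitzOnWith
  refine ⟨C * K, t ∩ f ⁻¹' s, inter_mem ht (hf.continuousOn p hp hs), ?_⟩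
  exact hC.comp (hK.mono inter_subset_left) (fun x hx => hx.2)

lemma locallyLipschitzOn_prodMk {β γ : Type*} [PseudoMetricSpace β] [PseudoMetricSpace γ]
    {D : Set α} {f : α → β} {g : α → γ}
    (hf : LocallyLipschitzOn D f) (hg : LocallyLipschitzOn D g) :
    LocallyLipschitzOn D (fun p => (f p, g p)) := by
  intro p hp
  obtain ⟨K, t, ht, hK⟩ := hf hp
  obtain ⟨C, s, hs, hC⟩ := hg hp
  exact ⟨max K C, t ∩ s, inter_mem ht hs,
    (hK.mono inter_subset_left).prodMk (hC.mono inter_subset_right)⟩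

lemma locallyLipschitzOn_real_mul {D : Set α} {f g : α → ℝ}
    (hf : LocallyLipschitzOn D f) (hg : LocallyLipschitzOn D g) :
    LocallyLipschitzOn D (fun p => f p * g p) :=
  locallyLipschitzOn_contDiffAt_comp (G := fun q : ℝ × ℝ => q.1 * q.2)
    (locallyLipschitzOn_prodMk hf hg) (fun _ _ => by fun_prop)

lemma locallyLipschitzOn_real_div {D : Set α} {f g : α → ℝ}
    (hf : LocallyLipschitzOn D f) (hg : LocallyLipschitzOn D g) (h0 : ∀ p ∈ D, g p ≠ 0) :
    LocallyLipschitzOn D (fun p => f p / g p) :=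
  locallyLipschitzOn_contDiffAt_comp (G := fun q : ℝ × ℝ => q.1 / q.2)
    (locallyLipschitzOn_prodMk hf hg) (fun p hp => by
      have := h0 p hp
      fun_prop (disch := exact this))

/-- A function which is locally Lipschitz on an open set and compactly supported there is
globally Lipschitz. -/
lemma exists_lipschitzWith_of_tsupport_subset {β γ : Type*} [NormedAddCommGroup β] [ProperSpace β]
    [NormedAddCommGroup γ] {D : Set β}
    (hD : IsOpen D) {f : β → γ} (hf : LocallyLipschitzOn D f) (hc : HasCompactSupport f)
    (hs : tsupport f ⊆ D) : ∃ K, LipschitzWith K f := by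
  have hloc : LocallyLipschitz f := by
    intro p
    by_cases hp : p ∈ D
    · obtain ⟨K, t, ht, hK⟩ := hf hp
      exact ⟨K, t, by rwa [hD.nhdsWithin_eq hp] at ht, hK⟩
    · refine ⟨0, (tsupport f)ᶜ, (isClosed_tsupport f).isOpen_compl.mem_nhds fun h => hp (hs h), ?_⟩
      intro x hx y hy
      simp [image_eq_zero_of_notMem_tsupport hx, image_eq_zero_of_notMem_tsupport hy]
  have hcont := hloc.continuous
  obtain ⟨K, hK⟩ := LocallyLipschitzOn.exists_lipschitzOnWith_of_compact
    (IsCompact.cthickening hc (r := 1)) (hloc.locallyLipschitzOn)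
  obtain ⟨C, hC⟩ := hc.exists_bound_of_continuous hcont
  have hC0 : 0 ≤ C := (norm_nonneg _).trans (hC 0)
  have key : ∀ x ∈ tsupport f, ∀ y, dist (f x) (f y) ≤ (K + C) * dist x y := by
    intro x hx y
    by_cases hy : y ∈ Metric.cthickening 1 (tsupport f)
    · refine (hK.dist_le_mul x (Metric.self_subset_cthickening _ hx) y hy).trans ?_
      gcongr
      linarith
    · have h0 : f y = 0 := by
        apply image_eq_zero_of_notMem_tsupport
        exact fun h => hy (Metric.self_subset_cthickening _ h)
      have h1 : 1 ≤ dist x y := by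
        by_contra! h
        exact hy (Metric.mem_cthickening_of_dist_le y x 1 _ hx (by rw [dist_comm]; exact h.le))
      rw [h0, dist_zero_right]
      have := hC x
      have hK0 : (0 : ℝ) ≤ K := K.2
      nlinarith
  refine ⟨K + ⟨C, hC0⟩, LipschitzWith.of_dist_le_mul fun x y => ?_⟩
  change _ ≤ ((K : ℝ) + C) * _
  by_cases hx : x ∈ tsupport f
  · exact key x hx y
  by_cases hy : y ∈ tsupport f
  · rw [dist_comm, dist_comm x]; exact key y hy x
  · rw [image_eq_zero_of_notMem_tsupport hx, image_eq_zero_of_notMem_tsupport hy, dist_self]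
    positivity

/-- Rademacher's theorem for locally Lipschitz functions on an open set. -/
lemma ae_differentiableAt_of_locallyLipschitzOn [FiniteDimensional ℝ E] [FiniteDimensional ℝ F]
    [MeasurableSpace E] [BorelSpace E] (μ : Measure E) [μ.IsAddHaarMeasure]
    {D : Set E} (hD : IsOpen D) {f : E → F} (hf : LocallyLipschitzOn D f) :
    ∀ᵐ p ∂(μ.restrict D), DifferentiableAt ℝ f p := by
  have : SecondCountableTopology E := secondCountable_of_proper (α := E)
  rw [ae_restrict_iff' hD.measurableSet, ae_iff]
  apply measure_null_of_locally_null
  intro p hp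
  have hpD : p ∈ D := by
    by_contra h
    exact hp fun h' => absurd h' h
  obtain ⟨K, t, ht, hK⟩ := hf hpD
  rw [hD.nhdsWithin_eq hpD] at ht
  obtain ⟨s, hst, hso, hps⟩ := mem_nhds_iff.1 ht
  refine ⟨s ∩ {a | ¬(a ∈ D → DifferentiableAt ℝ f a)}, ?_, ?_⟩
  · exact inter_mem (mem_nhdsWithin_of_mem_nhds (hso.mem_nhds hps)) self_mem_nhdsWithin
  · have := (hK.mono hst).ae_differentiableWithinAt_of_mem (μ := μ)
    rw [ae_iff] at this
    refine measure_mono_null ?_ this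
    rintro a ⟨has, ha⟩ h
    exact ha fun _ => (h has).differentiableAt (hso.mem_nhds has)

end LocallyLipschitz

/-- The integral of a directional derivative of a compactly supported Lipschitz function
vanishes. -/
lemma integral_fderiv_eq_zero_of_lipschitzWith {E : Type*} [NormedAddCommGroup E]
    [NormedSpace ℝ E] [FiniteDimensional ℝ E] [MeasurableSpace E] [BorelSpace E] (μ : Measure E)
    [μ.IsAddHaarMeasure] {f : E → ℝ} {K : NNReal} (hf : LipschitzWith K f)
    (hc : HasCompactSupport f) (v : E) : ∫ p, fderiv ℝ f p v ∂μ = 0 := by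
  have h := (LipschitzWith.const (α := E) (1 : ℝ)).integral_lineDeriv_mul_eq (μ := μ) hf hc (-v)
  simp only [neg_neg, mul_one] at h
  have h0 : ∀ x : E, lineDeriv ℝ (fun _ : E => (1 : ℝ)) x (-v) = 0 := by
    intro x; simp [lineDeriv]
  simp only [h0, zero_mul, integral_zero] at h
  rw [h]
  refine integral_congr_ae ?_
  filter_upwards [hf.ae_differentiableAt (μ := μ)] with x hx
  exact hx.lineDeriv_eq_fderiv.symm

/-- Integrability of the directional derivative of a compactly supported Lipschitz function. -/
lemma integrable_fderiv_of_lipschitzWith {E : Type*} [NormedAddCommGroup E]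
    [NormedSpace ℝ E] [FiniteDimensional ℝ E] [MeasurableSpace E] [BorelSpace E] (μ : Measure E)
    [μ.IsAddHaarMeasure] {f : E → ℝ} {K : NNReal} (hf : LipschitzWith K f)
    (hc : HasCompactSupport f) (v : E) : Integrable (fun p => fderiv ℝ f p v) μ := by
  have hm : AEStronglyMeasurable (fun p => fderiv ℝ f p v) μ :=
    (measurable_fderiv_apply_const ℝ f v).aestronglyMeasurable
  rw [← integrableOn_iff_integrable_of_support_subset (s := tsupport f)]
  · refine Measure.integrableOn_of_bounded (M := K * ‖v‖) hc.measure_lt_top.ne hm ?_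
    refine Eventually.of_forall fun p => ?_
    exact ((fderiv ℝ f p).le_opNorm v).trans (by gcongr; exact norm_fderiv_le_of_lipschitz ℝ hf)
  · intro p hp
    by_contra h
    apply hp
    have : f =ᶠ[𝓝 p] fun _ => 0 := by
      filter_upwards [(isClosed_tsupport f).isOpen_compl.mem_nhds h] with x hx
      exact image_eq_zero_of_notMem_tsupport hx
    simp [this.fderiv_eq]

/-- Second order expansion of `x ↦ √(1 + x²)` with a uniform cubic remainder. -/
lemma abs_sqrt_one_add_sq_sub_le (b δ : ℝ) (hδ : |δ| ≤ 1) :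
    |√(1 + (b + δ) ^ 2) - (√(1 + b ^ 2) + b / √(1 + b ^ 2) * δ
      + δ ^ 2 / (2 * √(1 + b ^ 2) ^ 3))| ≤ 2 * |δ| ^ 3 := by
  set r := √(1 + b ^ 2) with hr
  set R := √(1 + (b + δ) ^ 2) with hR
  have hr2 : r ^ 2 = 1 + b ^ 2 := Real.sq_sqrt (by positivity)
  have hR2 : R ^ 2 = 1 + (b + δ) ^ 2 := Real.sq_sqrt (by positivity)
  have hr1 : 1 ≤ r := Real.one_le_sqrt.2 (by nlinarith [sq_nonneg b])
  have hR1 : 1 ≤ R := Real.one_le_sqrt.2 (by nlinarith [sq_nonneg (b + δ)])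
  have hr0 : 0 < r := by linarith
  obtain ⟨k, hk⟩ : ∃ k, k = 1 / r := ⟨_, rfl⟩
  have hkr : k * r = 1 := by rw [hk]; field_simp
  have hk0 : 0 < k := by rw [hk]; positivity
  have hk1 : k ≤ 1 := by rw [hk, div_le_one hr0]; exact hr1
  have hbr : |b| ≤ r := Real.abs_le_sqrt (by linarith)
  obtain ⟨β, hβ⟩ : ∃ β, β = b / r := ⟨_, rfl⟩
  have hβb : β = b * k := by rw [hβ, hk]; ring
  have hβ1 : |β| ≤ 1 := by rw [hβ, abs_div, abs_of_pos hr0, div_le_one hr0]; exact hbr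
  have e1 : δ ^ 2 / (2 * r ^ 3) = k ^ 3 * δ ^ 2 / 2 := by rw [hk]; field_simp
  rw [e1, ← hβ]
  set T := r + β * δ + k ^ 3 * δ ^ 2 / 2 with hT
  have hT0 : 0 ≤ T := by
    have : |β * δ| ≤ 1 := by
      rw [abs_mul]; exact mul_le_one₀ hβ1 (abs_nonneg _) hδ
    have h2 := neg_abs_le (β * δ)
    have h3 : 0 ≤ k ^ 3 * δ ^ 2 / 2 := by positivity
    linarith
  have hbr' : β * r = b := by rw [hβb]; linear_combination b * hkr
  have hkb : k ^ 2 * (1 + b ^ 2) = 1 := by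
    rw [← hr2, ← mul_pow, hkr, one_pow]
  have hfac : (R - T) * (R + T) = -(β * k ^ 3 * δ ^ 3 + k ^ 6 * δ ^ 4 / 4) := by
    have hb2 : β ^ 2 + k ^ 2 = 1 := by rw [hβb]; linear_combination hkb
    have : T ^ 2 = R ^ 2 + (β * k ^ 3 * δ ^ 3 + k ^ 6 * δ ^ 4 / 4) := by
      rw [hT, hR2]
      linear_combination hr2 + 2 * δ * hbr' + δ ^ 2 * k ^ 2 * hkr + δ ^ 2 * hb2
    linear_combination -this
  have hle : |R - T| ≤ |R - T| * |R + T| := by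
    apply le_mul_of_one_le_right (abs_nonneg _)
    rw [abs_of_nonneg (by linarith)]; linarith
  rw [← abs_mul, hfac, abs_neg] at hle
  refine hle.trans ((abs_add_le _ _).trans ?_)
  have hk3 : k ^ 3 ≤ 1 := pow_le_one₀ hk0.le hk1
  have hk6 : k ^ 6 ≤ 1 := pow_le_one₀ hk0.le hk1
  have a1 : |β * k ^ 3 * δ ^ 3| ≤ |δ| ^ 3 := by
    rw [abs_mul, abs_mul, abs_pow δ, abs_of_pos (pow_pos hk0 3)]
    exact mul_le_of_le_one_left (by positivity) (mul_le_one₀ hβ1 (by positivity) hk3)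
  have a2 : |k ^ 6 * δ ^ 4 / 4| ≤ |δ| ^ 3 := by
    rw [abs_div, abs_mul, abs_pow δ, abs_of_pos (pow_pos hk0 6), abs_of_pos (by norm_num : (0:ℝ) < 4)]
    have : |δ| ^ 4 ≤ |δ| ^ 3 := pow_le_pow_of_le_one (abs_nonneg _) hδ (by norm_num)
    have h3 : k ^ 6 * |δ| ^ 4 ≤ |δ| ^ 4 := mul_le_of_le_one_left (by positivity) hk6
    have h4 : 0 ≤ k ^ 6 * |δ| ^ 4 := by positivity
    linarith
  linarith

/-- Pointwise form of the second variation of `ε ↦ √(1 + (b + ε l + ε² m)²)`. -/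
lemma abs_sqrt_one_add_sq_second_variation {b l m C ε : ℝ} (hL : |l| ≤ C) (hM : |m| ≤ C)
    (hε' : |ε| * (2 * C + 1) ≤ 1) :
    |√(1 + (b + ε * l + ε ^ 2 * m) ^ 2)
        - (√(1 + b ^ 2) + ε * (b / √(1 + b ^ 2) * l) + ε ^ 2 *
          (b / √(1 + b ^ 2) * m + l ^ 2 / (2 * √(1 + b ^ 2) ^ 3)))|
      ≤ (16 * C ^ 3 + 2 * C ^ 2) * |ε| ^ 3 := by
  have hC : 0 ≤ C := (abs_nonneg _).trans hL
  have hεC : 0 ≤ |ε| * C := by positivity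
  have hε1 : |ε| ≤ 1 := by nlinarith [abs_nonneg ε]
  have hr1 : 1 ≤ √(1 + b ^ 2) := Real.one_le_sqrt.2 (by nlinarith [sq_nonneg b])
  have hd : |ε * l + ε ^ 2 * m| ≤ 2 * C * |ε| := by
    refine (abs_add_le _ _).trans ?_
    rw [abs_mul, abs_mul, abs_pow]
    have : |ε| ^ 2 ≤ |ε| := by nlinarith [abs_nonneg ε]
    have i1 : |ε| * |l| ≤ |ε| * C := by gcongr
    have i2 : |ε| ^ 2 * |m| ≤ |ε| * C := by gcongr
    linarith
  have hx := abs_sqrt_one_add_sq_sub_le b (ε * l + ε ^ 2 * m) (hd.trans (by linarith [abs_nonneg ε]))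
  have hk0 : 0 ≤ 1 / (2 * √(1 + b ^ 2) ^ 3) := by positivity

  have split : √(1 + (b + ε * l + ε ^ 2 * m) ^ 2)
      - (√(1 + b ^ 2) + ε * (b / √(1 + b ^ 2) * l) + ε ^ 2 *
        (b / √(1 + b ^ 2) * m + l ^ 2 / (2 * √(1 + b ^ 2) ^ 3)))
      = (√(1 + (b + (ε * l + ε ^ 2 * m)) ^ 2) - (√(1 + b ^ 2)
        + b / √(1 + b ^ 2) * (ε * l + ε ^ 2 * m)
        + (ε * l + ε ^ 2 * m) ^ 2 / (2 * √(1 + b ^ 2) ^ 3)))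
        + (2 * ε ^ 3 * (l * m) + ε ^ 4 * m ^ 2) * (1 / (2 * √(1 + b ^ 2) ^ 3)) := by
    rw [← add_assoc b]; ring
  have t1 : 2 * |ε * l + ε ^ 2 * m| ^ 3 ≤ 16 * C ^ 3 * |ε| ^ 3 := by
    have := pow_le_pow_left₀ (abs_nonneg _) hd 3
    nlinarith
  have t2 : |(2 * ε ^ 3 * (l * m) + ε ^ 4 * m ^ 2) * (1 / (2 * √(1 + b ^ 2) ^ 3))|
      ≤ |ε| ^ 3 * (3 * C ^ 2) * (1 / (2 * √(1 + b ^ 2) ^ 3)) := by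
    rw [abs_mul, abs_of_nonneg hk0]
    gcongr
    refine (abs_add_le _ _).trans ?_
    rw [abs_mul, abs_mul, abs_mul, abs_mul, abs_pow, abs_pow, abs_pow, abs_two]
    have i1 : |l| * |m| ≤ C * C := by gcongr
    have i2 : |m| ^ 2 ≤ C ^ 2 := by gcongr
    have i3 : |ε| ^ 4 ≤ |ε| ^ 3 := pow_le_pow_of_le_one (abs_nonneg _) hε1 (by norm_num)
    have i4 : |ε| ^ 4 * |m| ^ 2 ≤ |ε| ^ 3 * C ^ 2 := by gcongr
    have i5 : |ε| ^ 3 * (|l| * |m|) ≤ |ε| ^ 3 * (C * C) := by gcongr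
    linarith
  have t3 : 1 / (2 * √(1 + b ^ 2) ^ 3) ≤ 1 / 2 := by
    have := one_le_pow₀ (hr1) (n := 3)
    apply one_div_le_one_div_of_le <;> linarith
  have t4 : |ε| ^ 3 * (3 * C ^ 2) * (1 / (2 * √(1 + b ^ 2) ^ 3))
      ≤ |ε| ^ 3 * (3 * C ^ 2) * (1 / 2) := by gcongr
  have t5 : 0 ≤ |ε| ^ 3 * C ^ 2 := by positivity
  rw [split]
  refine ((abs_add_le _ _).trans (add_le_add (hx.trans t1) (t2.trans t4))).trans ?_
  linarith

/-- The integrand of the second variation of `∫ √(1 + (b + ε L + ε² M)²)` is integrable. -/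
lemma integrable_second_variation {α : Type*} [MeasurableSpace α] {μ : Measure α}
    [IsFiniteMeasure μ] {b L M : α → ℝ} {C : ℝ} (hbm : AEStronglyMeasurable b μ)
    (hLm : AEStronglyMeasurable L μ) (hMm : AEStronglyMeasurable M μ)
    (hLC : ∀ᵐ p ∂μ, |L p| ≤ C) (hMC : ∀ᵐ p ∂μ, |M p| ≤ C) :
    Integrable (fun p => b p / √(1 + b p ^ 2) * M p + L p ^ 2 / (2 * √(1 + b p ^ 2) ^ 3)) μ := by
  have hr1 : ∀ x : ℝ, 1 ≤ √(1 + x ^ 2) := fun x => Real.one_le_sqrt.2 (by nlinarith [sq_nonneg x])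
  have hg1 : ∀ x : ℝ, |x / √(1 + x ^ 2)| ≤ 1 := fun x => by
    rw [abs_div, abs_of_pos (by linarith [hr1 x] : (0:ℝ) < √(1 + x ^ 2)),
      div_le_one (by linarith [hr1 x])]
    exact Real.abs_le_sqrt (by linarith)
  have hc1 : ∀ x : ℝ, 1 / (2 * √(1 + x ^ 2) ^ 3) ≤ 1 := fun x => by
    have := one_le_pow₀ (hr1 x) (n := 3)
    rw [div_le_one (by positivity)]; linarith
  have hgcont : Continuous fun x : ℝ => x / √(1 + x ^ 2) :=
    continuous_id.div (by fun_prop) fun x => by have := hr1 x; positivity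
  have hccont : Continuous fun x : ℝ => 1 / (2 * √(1 + x ^ 2) ^ 3) :=
    continuous_const.div (by fun_prop) fun x => by have := hr1 x; positivity
  have hgm : AEStronglyMeasurable (fun p => b p / √(1 + b p ^ 2)) μ :=
    hgcont.comp_aestronglyMeasurable hbm
  have hcm : AEStronglyMeasurable (fun p => 1 / (2 * √(1 + b p ^ 2) ^ 3)) μ :=
    hccont.comp_aestronglyMeasurable hbm
  apply Integrable.add
  · refine Integrable.of_bound (hgm.mul hMm) C ?_
    filter_upwards [hMC] with p hM
    rw [Real.norm_eq_abs, abs_mul]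
    nlinarith [hg1 (b p), abs_nonneg (M p)]
  · have e : (fun p => L p ^ 2 / (2 * √(1 + b p ^ 2) ^ 3))
        = fun p => L p ^ 2 * (1 / (2 * √(1 + b p ^ 2) ^ 3)) := by ext p; ring
    rw [e]
    refine Integrable.of_bound ((hLm.pow 2).mul hcm) (C ^ 2) ?_
    filter_upwards [hLC] with p hL
    have h0 : 0 ≤ 1 / (2 * √(1 + b p ^ 2) ^ 3) := by positivity
    rw [Real.norm_eq_abs, abs_mul, abs_of_nonneg h0, abs_pow]
    calc |L p| ^ 2 * (1 / (2 * √(1 + b p ^ 2) ^ 3)) ≤ C ^ 2 * 1 := by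
          gcongr; exact hc1 _
      _ = C ^ 2 := mul_one _

/-- An integral functional `ε ↦ ∫ √(1 + (b + ε L + ε² M)²)` with vanishing first variation and
positive second variation is stationary and locally minimal at `ε = 0`. -/
lemma hasDerivAt_and_le_of_second_variation {α : Type*} [MeasurableSpace α] {μ : Measure α}
    [IsFiniteMeasure μ] {b L M : α → ℝ} {C : ℝ} (hC : 0 ≤ C)
    (hbm : AEStronglyMeasurable b μ) (hLm : AEStronglyMeasurable L μ)
    (hMm : AEStronglyMeasurable M μ)
    (hbC : ∀ᵐ p ∂μ, |b p| ≤ C) (hLC : ∀ᵐ p ∂μ, |L p| ≤ C) (hMC : ∀ᵐ p ∂μ, |M p| ≤ C)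
    (h1 : ∫ p, b p / √(1 + b p ^ 2) * L p ∂μ = 0)
    (h2 : 0 < ∫ p, (b p / √(1 + b p ^ 2) * M p + L p ^ 2 / (2 * √(1 + b p ^ 2) ^ 3)) ∂μ) :
    HasDerivAt (fun ε : ℝ => ∫ p, √(1 + (b p + ε * L p + ε ^ 2 * M p) ^ 2) ∂μ) 0 0 ∧
    ∃ ε₀ > (0 : ℝ), ∀ ε : ℝ, |ε| < ε₀ →
      ∫ p, √(1 + b p ^ 2) ∂μ ≤ ∫ p, √(1 + (b p + ε * L p + ε ^ 2 * M p) ^ 2) ∂μ := by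
  set I := ∫ p, (b p / √(1 + b p ^ 2) * M p + L p ^ 2 / (2 * √(1 + b p ^ 2) ^ 3)) ∂μ with hI
  set F : ℝ → ℝ := fun ε => ∫ p, √(1 + (b p + ε * L p + ε ^ 2 * M p) ^ 2) ∂μ with hF
  have hr1 : ∀ x : ℝ, 1 ≤ √(1 + x ^ 2) := fun x => Real.one_le_sqrt.2 (by nlinarith [sq_nonneg x])
  have hg1 : ∀ x : ℝ, |x / √(1 + x ^ 2)| ≤ 1 := fun x => by
    rw [abs_div, abs_of_pos (by linarith [hr1 x] : (0:ℝ) < √(1 + x ^ 2)),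
      div_le_one (by linarith [hr1 x])]
    exact Real.abs_le_sqrt (by linarith)
  have hgcont : Continuous fun x : ℝ => x / √(1 + x ^ 2) :=
    continuous_id.div (by fun_prop) fun x => by have := hr1 x; positivity
  have hgm : AEStronglyMeasurable (fun p => b p / √(1 + b p ^ 2)) μ :=
    hgcont.comp_aestronglyMeasurable hbm
  have hFi : ∀ ε : ℝ, Integrable (fun p => √(1 + (b p + ε * L p + ε ^ 2 * M p) ^ 2)) μ := by
    intro ε
    have hm : AEStronglyMeasurable (fun p => √(1 + (b p + ε * L p + ε ^ 2 * M p) ^ 2)) μ :=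
      (by fun_prop : Continuous fun x : ℝ => √(1 + x ^ 2)).comp_aestronglyMeasurable
        ((hbm.add (hLm.const_mul ε)).add (hMm.const_mul (ε ^ 2)))
    refine Integrable.of_bound hm (√(1 + (C + |ε| * C + ε ^ 2 * C) ^ 2)) ?_
    filter_upwards [hbC, hLC, hMC] with p hb hL hM
    rw [Real.norm_eq_abs, abs_of_nonneg (Real.sqrt_nonneg _)]
    apply Real.sqrt_le_sqrt
    have : |b p + ε * L p + ε ^ 2 * M p| ≤ C + |ε| * C + ε ^ 2 * C := by
      refine (abs_add_three _ _ _).trans ?_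
      rw [abs_mul, abs_mul, abs_of_nonneg (sq_nonneg ε)]
      gcongr
    have h2 := pow_le_pow_left₀ (abs_nonneg _) this 2
    rw [sq_abs] at h2
    linarith
  have hrad : (fun p => √(1 + (b p + 0 * L p + 0 ^ 2 * M p) ^ 2)) = fun p => √(1 + b p ^ 2) := by
    ext p; simp
  have hri : Integrable (fun p => √(1 + b p ^ 2)) μ := by
    rw [← hrad]; exact hFi 0
  have hF0 : F 0 = ∫ p, √(1 + b p ^ 2) ∂μ := by simp only [hF]; rw [← hrad]
  have hgLi : Integrable (fun p => b p / √(1 + b p ^ 2) * L p) μ := by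
    refine Integrable.of_bound (hgm.mul hLm) C ?_
    filter_upwards [hLC] with p hL
    rw [Real.norm_eq_abs, abs_mul]
    nlinarith [hg1 (b p), abs_nonneg (L p)]
  have hQi := integrable_second_variation hbm hLm hMm hLC hMC
  set A := 16 * C ^ 3 + 2 * C ^ 2 with hA
  have hA0 : 0 ≤ A := by positivity
  set m := μ.real univ with hm
  have hm0 : 0 ≤ m := measureReal_nonneg
  set ε₁ := 1 / (2 * C + 1) with hε₁
  have hε₁0 : 0 < ε₁ := by positivity
  have main : ∀ ε : ℝ, |ε| ≤ ε₁ → |F ε - (F 0 + ε ^ 2 * I)| ≤ A * m * |ε| ^ 3 := by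
    intro ε hε
    have hε' : |ε| * (2 * C + 1) ≤ 1 := by
      rwa [hε₁, le_div_iff₀ (by positivity)] at hε
    have e : F ε - (F 0 + ε ^ 2 * I) = ∫ p, (√(1 + (b p + ε * L p + ε ^ 2 * M p) ^ 2)
        - (√(1 + b p ^ 2) + ε * (b p / √(1 + b p ^ 2) * L p) + ε ^ 2 *
          (b p / √(1 + b p ^ 2) * M p + L p ^ 2 / (2 * √(1 + b p ^ 2) ^ 3)))) ∂μ := by
      have i1 : Integrable (fun p => √(1 + b p ^ 2) + ε * (b p / √(1 + b p ^ 2) * L p)) μ :=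
        hri.add (hgLi.const_mul ε)
      have i2 := hQi.const_mul (ε ^ 2)
      have i3 : Integrable (fun p => √(1 + b p ^ 2) + ε * (b p / √(1 + b p ^ 2) * L p) + ε ^ 2 *
          (b p / √(1 + b p ^ 2) * M p + L p ^ 2 / (2 * √(1 + b p ^ 2) ^ 3))) μ := i1.add i2
      rw [integral_sub (hFi ε) i3, integral_add i1 i2,
        integral_add hri (hgLi.const_mul ε), integral_const_mul, integral_const_mul, h1, hF0, hI]
      ring
    rw [e, ← Real.norm_eq_abs]
    have := norm_integral_le_of_norm_le_const (μ := μ) (C := A * |ε| ^ 3)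
      (f := fun p => √(1 + (b p + ε * L p + ε ^ 2 * M p) ^ 2)
        - (√(1 + b p ^ 2) + ε * (b p / √(1 + b p ^ 2) * L p) + ε ^ 2 *
          (b p / √(1 + b p ^ 2) * M p + L p ^ 2 / (2 * √(1 + b p ^ 2) ^ 3)))) ?_
    · refine this.trans (le_of_eq ?_)
      ring
    filter_upwards [hLC, hMC] with p hL hM
    exact abs_sqrt_one_add_sq_second_variation hL hM hε'
  refine ⟨?_, ?_⟩
  · rw [hasDerivAt_iff_isLittleO_nhds_zero]
    have hO : (fun h : ℝ => F (0 + h) - F 0 - h • (0 : ℝ)) =O[𝓝 0] fun h => h ^ 2 := by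
      refine Asymptotics.IsBigO.of_bound (A * m + I) ?_
      filter_upwards [Metric.ball_mem_nhds (0 : ℝ) (lt_min hε₁0 one_pos)] with h hh
      have hh' : |h| < min ε₁ 1 := by simpa using hh
      have hm := main h (hh'.le.trans (min_le_left _ _))
      have hh1 : |h| ≤ 1 := hh'.le.trans (min_le_right _ _)
      simp only [zero_add, smul_zero, sub_zero, Real.norm_eq_abs, abs_pow]
      have : |F h - F 0| ≤ |F h - (F 0 + h ^ 2 * I)| + |h ^ 2 * I| := by
        refine le_trans (le_of_eq ?_) (abs_add_le _ _)
        congr 1; ring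
      rw [abs_mul, abs_pow, abs_of_pos h2] at this
      have h3 : |h| ^ 3 ≤ |h| ^ 2 := pow_le_pow_of_le_one (abs_nonneg _) hh1 (by norm_num)
      have h4 : A * m * |h| ^ 3 ≤ A * m * |h| ^ 2 := by gcongr
      linarith
    refine hO.trans_isLittleO ?_
    simpa using Asymptotics.isLittleO_pow_id (𝕜 := ℝ) (n := 2) (by norm_num)
  · refine ⟨min ε₁ (I / (A * m + 1)), lt_min hε₁0 (by positivity), fun ε hε => ?_⟩
    rw [← hF0]
    have hm' := main ε (hε.le.trans (min_le_left _ _))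
    have hε2 : |ε| * (A * m + 1) ≤ I := by
      have := hε.le.trans (min_le_right _ _)
      rwa [le_div_iff₀ (by positivity)] at this
    have h4 := (abs_le.1 hm').1
    have h5 : A * m * |ε| ^ 3 ≤ ε ^ 2 * I := by
      rw [← sq_abs ε]
      have : |ε| ^ 2 * (|ε| * (A * m + 1)) ≤ |ε| ^ 2 * I := by gcongr
      have h6 : 0 ≤ |ε| ^ 3 := by positivity
      nlinarith
    change F 0 ≤ F ε
    linarith

lemma setIntegral_fderiv_eq_zero {D : Set (ℝ × ℝ)} (hD : IsOpen D) {f : ℝ × ℝ → ℝ}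
    (hf : LocallyLipschitzOn D f) (hc : HasCompactSupport f) (hs : tsupport f ⊆ D) (v : ℝ × ℝ) :
    IntegrableOn (fun p => fderiv ℝ f p v) D ∧ ∫ p in D, fderiv ℝ f p v = 0 := by
  obtain ⟨K, hK⟩ := exists_lipschitzWith_of_tsupport_subset hD hf hc hs
  refine ⟨(integrable_fderiv_of_lipschitzWith volume hK hc v).integrableOn, ?_⟩
  rw [setIntegral_eq_integral_of_forall_compl_eq_zero,
    integral_fderiv_eq_zero_of_lipschitzWith volume hK hc v]
  intro p hp
  have : fderiv ℝ f p = 0 := by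
    by_contra h
    exact hp (hs (support_fderiv_subset ℝ h))
  simp [this]

/-- The adjoint of the Burgers operator `∂_y - 4u∂_t` annihilates constants. -/
lemma setIntegral_burgers_eq_zero {D : Set (ℝ × ℝ)} (hD : IsOpen D) {u f : ℝ × ℝ → ℝ}
    (hu : LocallyLipschitzOn D u) (hf : LocallyLipschitzOn D f) (hc : HasCompactSupport f)
    (hs : tsupport f ⊆ D) :
    IntegrableOn (fun p => fderiv ℝ f p (1, 0) - 4 * u p * fderiv ℝ f p (0, 1)
      - 4 * fderiv ℝ u p (0, 1) * f p) D ∧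
    ∫ p in D, (fderiv ℝ f p (1, 0) - 4 * u p * fderiv ℝ f p (0, 1)
      - 4 * fderiv ℝ u p (0, 1) * f p) = 0 := by
  obtain ⟨i1, e1⟩ := setIntegral_fderiv_eq_zero hD hf hc hs (1, 0)
  obtain ⟨i2, e2⟩ := setIntegral_fderiv_eq_zero hD (locallyLipschitzOn_real_mul hu hf)
    (HasCompactSupport.mul_left hc) ((tsupport_mul_subset_right (f := u) (g := f)).trans hs) (0, 1)
  have hae : (fun p => fderiv ℝ f p (1, 0) - 4 * fderiv ℝ (fun p => u p * f p) p (0, 1))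
      =ᵐ[volume.restrict D] fun p => fderiv ℝ f p (1, 0) - 4 * u p * fderiv ℝ f p (0, 1)
        - 4 * fderiv ℝ u p (0, 1) * f p := by
    filter_upwards [ae_differentiableAt_of_locallyLipschitzOn volume hD hu,
      ae_differentiableAt_of_locallyLipschitzOn volume hD hf] with p hup hfp
    rw [fderiv_fun_mul hup hfp]
    simp only [add_apply, smul_apply, smul_eq_mul]
    ring
  have i3 := i1.sub (i2.const_mul 4)
  refine ⟨i3.congr hae, ?_⟩
  rw [← integral_congr_ae hae, integral_sub i1 (i2.const_mul 4), integral_const_mul, e1, e2]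
  simp

lemma one_le_sqrt_one_add_sq (x : ℝ) : 1 ≤ √(1 + x ^ 2) :=
  Real.one_le_sqrt.2 (by nlinarith [sq_nonneg x])

lemma contDiff_div_sqrt_one_add_sq : ContDiff ℝ 1 fun x : ℝ => x / √(1 + x ^ 2) :=
  contDiff_id.div ((by fun_prop : ContDiff ℝ 1 fun x : ℝ => 1 + x ^ 2).sqrt
    fun x => by positivity) fun x => by have := one_le_sqrt_one_add_sq x; positivity

lemma contDiff_inv_sqrt_one_add_sq_pow : ContDiff ℝ 1 fun x : ℝ => 1 / √(1 + x ^ 2) ^ 3 :=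
  contDiff_const.div (((by fun_prop : ContDiff ℝ 1 fun x : ℝ => 1 + x ^ 2).sqrt
    fun x => by positivity).pow 3) fun x => by have := one_le_sqrt_one_add_sq x; positivity

lemma hasDerivAt_div_sqrt_one_add_sq (x : ℝ) :
    HasDerivAt (fun x : ℝ => x / √(1 + x ^ 2)) (1 / √(1 + x ^ 2) ^ 3) x := by
  have h0 : 0 < 1 + x ^ 2 := by positivity
  have hr : 0 < √(1 + x ^ 2) := Real.sqrt_pos.2 h0
  have h1 : HasDerivAt (fun x : ℝ => 1 + x ^ 2) (2 * x) x := by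
    simpa using ((hasDerivAt_pow 2 x).const_add 1)
  have h2 := (hasDerivAt_id' x).div (h1.sqrt h0.ne') hr.ne'
  refine h2.congr_deriv ?_
  have hsq : √(1 + x ^ 2) ^ 2 = 1 + x ^ 2 := Real.sq_sqrt h0.le
  field_simp
  linear_combination hsq

/-- A Lipschitz solution `u` of the Burgers-type equation `B(Bu) = 0`, `B = ∂_y - 4u∂_t`, for which
the Riccati inequality of the second variation has a locally Lipschitz solution `ψ`, is stationary
and locally minimal for the intrinsic area. -/
theorem intrinsicArea_stationary_of_riccati {D : Set (ℝ × ℝ)} (hD : IsOpen D)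
    (hDfin : volume D ≠ ⊤) {u b ψ : ℝ × ℝ → ℝ} {K : NNReal} {C₀ : ℝ}
    (hu : LipschitzOnWith K u D) (huC : ∀ p ∈ D, |u p| ≤ C₀)
    (hb : LocallyLipschitzOn D b) (hψ : LocallyLipschitzOn D ψ)
    (hBu : ∀ᵐ p ∂(volume.restrict D),
      fderiv ℝ u p (1, 0) - 4 * u p * fderiv ℝ u p (0, 1) = b p)
    (hBb : ∀ᵐ p ∂(volume.restrict D), fderiv ℝ b p (1, 0) = 4 * u p * fderiv ℝ b p (0, 1))
    (hric : ∀ᵐ p ∂(volume.restrict D),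
      0 < 4 * fderiv ℝ b p (0, 1) - (fderiv ℝ ψ p (1, 0) - 4 * u p * fderiv ℝ ψ p (0, 1))
        - 4 * fderiv ℝ u p (0, 1) * ψ p - ψ p ^ 2)
    {w : ℝ × ℝ → ℝ} (hw : ContDiff ℝ (⊤ : ℕ∞) w) (hwc : HasCompactSupport w)
    (hws : tsupport w ⊆ D) :
    HasDerivAt
      (fun ε : ℝ => ∫ p in D, √(1 + ((fderiv ℝ u p (1, 0) + ε * fderiv ℝ w p (1, 0))
        - 4 * (u p + ε * w p) * (fderiv ℝ u p (0, 1) + ε * fderiv ℝ w p (0, 1))) ^ 2)) 0 0 ∧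
    ∃ ε₀ > (0 : ℝ), ∀ ε : ℝ, |ε| < ε₀ →
      (∫ p in D, √(1 + (fderiv ℝ u p (1, 0) - 4 * u p * fderiv ℝ u p (0, 1)) ^ 2))
      ≤ ∫ p in D, √(1 + ((fderiv ℝ u p (1, 0) + ε * fderiv ℝ w p (1, 0))
        - 4 * (u p + ε * w p) * (fderiv ℝ u p (0, 1) + ε * fderiv ℝ w p (0, 1))) ^ 2) := by
  by_cases hw0 : w = 0
  · subst hw0
    have h0 : fderiv ℝ (0 : ℝ × ℝ → ℝ) = 0 := by ext1 p; simp
    simp only [h0, Pi.zero_apply, mul_zero, add_zero, zero_apply, le_refl,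
      implies_true, and_true]
    exact ⟨hasDerivAt_const _ _, 1, one_pos⟩
  obtain ⟨p₀, hp₀⟩ : ∃ p, w p ≠ 0 := by
    by_contra! h
    exact hw0 (funext h)
  have hfin : IsFiniteMeasure (volume.restrict D) := ⟨by
    rw [Measure.restrict_apply_univ]; exact hDfin.lt_top⟩
  have huL : LocallyLipschitzOn D u := fun p _ => ⟨K, D, self_mem_nhdsWithin, hu⟩
  have hw1 : ContDiff ℝ 1 w := hw.of_le (by exact_mod_cast le_top)
  have hwL : LocallyLipschitzOn D w := hw1.locallyLipschitz.locallyLipschitzOn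
  have hwd : ∀ p, DifferentiableAt ℝ w p := fun p => (hw1.differentiable one_ne_zero) p
  have hmem : ∀ᵐ p ∂(volume.restrict D), p ∈ D := ae_restrict_mem hD.measurableSet
  have hbd := ae_differentiableAt_of_locallyLipschitzOn volume hD hb
  have hψd := ae_differentiableAt_of_locallyLipschitzOn volume hD hψ
  set L : ℝ × ℝ → ℝ := fun p => fderiv ℝ w p (1, 0) - 4 * u p * fderiv ℝ w p (0, 1)
    - 4 * w p * fderiv ℝ u p (0, 1) with hL
  set M : ℝ × ℝ → ℝ := fun p => -4 * w p * fderiv ℝ w p (0, 1) with hM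
  -- measurability
  have hum : AEStronglyMeasurable u (volume.restrict D) :=
    hu.continuousOn.aestronglyMeasurable hD.measurableSet
  have hbm : AEStronglyMeasurable b (volume.restrict D) :=
    hb.continuousOn.aestronglyMeasurable hD.measurableSet
  have hwm : AEStronglyMeasurable w (volume.restrict D) :=
    hw1.continuous.aestronglyMeasurable
  have hdm : ∀ (f : ℝ × ℝ → ℝ) (v : ℝ × ℝ),
      AEStronglyMeasurable (fun p => fderiv ℝ f p v) (volume.restrict D) := fun f v =>
    (measurable_fderiv_apply_const ℝ f v).aestronglyMeasurable
  have hLm : AEStronglyMeasurable L (volume.restrict D) :=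
    ((hdm w _).sub ((hum.const_mul 4).mul (hdm w _))).sub ((hwm.const_mul 4).mul (hdm u _))
  have hMm : AEStronglyMeasurable M (volume.restrict D) := (hwm.const_mul (-4)).mul (hdm w _)
  -- bounds
  obtain ⟨W, hW⟩ := hwc.exists_bound_of_continuous hw1.continuous
  obtain ⟨W₁, hW₁⟩ := (hwc.fderiv (𝕜 := ℝ)).exists_bound_of_continuous
    (hw1.continuous_fderiv one_ne_zero)
  have hW0 : 0 ≤ W := (norm_nonneg _).trans (hW 0)
  have hW10 : 0 ≤ W₁ := (norm_nonneg _).trans (hW₁ 0)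
  have hn1 : ‖((1 : ℝ), (0 : ℝ))‖ = 1 := by simp [Prod.norm_def]
  have hn2 : ‖((0 : ℝ), (1 : ℝ))‖ = 1 := by simp [Prod.norm_def]
  have hwy : ∀ p, |fderiv ℝ w p (1, 0)| ≤ W₁ := fun p => by
    have := (fderiv ℝ w p).le_opNorm (1, 0)
    rw [hn1, mul_one] at this; exact this.trans (hW₁ p)
  have hwt : ∀ p, |fderiv ℝ w p (0, 1)| ≤ W₁ := fun p => by
    have := (fderiv ℝ w p).le_opNorm (0, 1)
    rw [hn2, mul_one] at this; exact this.trans (hW₁ p)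
  have hun : ∀ p ∈ D, ‖fderiv ℝ u p‖ ≤ K := fun p hp =>
    norm_fderiv_le_of_lipschitzOn ℝ (hD.mem_nhds hp) hu
  have huy : ∀ p ∈ D, |fderiv ℝ u p (1, 0)| ≤ K := fun p hp => by
    have := (fderiv ℝ u p).le_opNorm (1, 0)
    rw [hn1, mul_one] at this; exact this.trans (hun p hp)
  have hut : ∀ p ∈ D, |fderiv ℝ u p (0, 1)| ≤ K := fun p hp => by
    have := (fderiv ℝ u p).le_opNorm (0, 1)
    rw [hn2, mul_one] at this; exact this.trans (hun p hp)
  have hC₀ : 0 ≤ C₀ := by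
    have : p₀ ∈ D := hws (subset_tsupport _ hp₀)
    exact (abs_nonneg _).trans (huC p₀ this)
  have hK0 : (0 : ℝ) ≤ K := K.2
  obtain ⟨C, hC, hCb, hCL, hCM⟩ : ∃ C : ℝ, 0 ≤ C ∧ K + 4 * C₀ * K ≤ C ∧
      W₁ + 4 * C₀ * W₁ + 4 * W * K ≤ C ∧ 4 * W * W₁ ≤ C := by
    have n1 : 0 ≤ C₀ * K := by positivity
    have n2 : 0 ≤ C₀ * W₁ := by positivity
    have n3 : 0 ≤ W * K := by positivity
    have n4 : 0 ≤ W * W₁ := by positivity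
    exact ⟨K + 4 * C₀ * K + (W₁ + 4 * C₀ * W₁ + 4 * W * K) + 4 * W * W₁, by positivity,
      by nlinarith, by nlinarith, by nlinarith⟩
  have hbC : ∀ᵐ p ∂(volume.restrict D), |b p| ≤ C := by
    filter_upwards [hmem, hBu] with p hp hbp
    rw [← hbp]
    refine ((abs_sub _ _).trans ?_).trans hCb
    rw [abs_mul, abs_mul, abs_of_pos (by norm_num : (0 : ℝ) < 4)]
    have := huC p hp; have := huy p hp; have := hut p hp
    gcongr
  have hLC : ∀ᵐ p ∂(volume.restrict D), |L p| ≤ C := by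
    filter_upwards [hmem] with p hp
    refine ((abs_sub _ _).trans (add_le_add_left (abs_sub _ _) _)).trans (le_trans ?_ hCL)
    rw [abs_mul, abs_mul, abs_mul, abs_mul, abs_of_pos (by norm_num : (0 : ℝ) < 4)]
    have := huC p hp; have := hut p hp; have := hwy p; have := hwt p; have h5 := hW p
    rw [Real.norm_eq_abs] at h5
    gcongr
  have hMC : ∀ᵐ p ∂(volume.restrict D), |M p| ≤ C := by
    refine Eventually.of_forall fun p => le_trans ?_ hCM
    simp only [hM]
    rw [abs_mul, abs_mul, abs_neg, abs_of_pos (by norm_num : (0 : ℝ) < 4)]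
    have := hwt p; have h5 := hW p
    rw [Real.norm_eq_abs] at h5
    gcongr
  -- test functions built from `b`, `ψ` and `w`
  have hgL : LocallyLipschitzOn D fun p => b p / √(1 + b p ^ 2) :=
    locallyLipschitzOn_contDiffAt_comp hb fun _ _ => contDiff_div_sqrt_one_add_sq.contDiffAt
  have hcL : LocallyLipschitzOn D fun p => 1 / √(1 + b p ^ 2) ^ 3 :=
    locallyLipschitzOn_contDiffAt_comp (G := fun x : ℝ => 1 / √(1 + x ^ 2) ^ 3) hb
      fun _ _ => contDiff_inv_sqrt_one_add_sq_pow.contDiffAt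
  have hsupp : ∀ f : ℝ × ℝ → ℝ, HasCompactSupport (fun p => f p * w p) ∧
      tsupport (fun p => f p * w p) ⊆ D := fun f =>
    ⟨HasCompactSupport.mul_left hwc, (tsupport_mul_subset_right (f := f) (g := w)).trans hws⟩
  obtain ⟨iA, eA⟩ := setIntegral_burgers_eq_zero hD huL (locallyLipschitzOn_real_mul hgL hwL)
    (hsupp _).1 (hsupp _).2
  obtain ⟨iB, eB⟩ := setIntegral_burgers_eq_zero hD huL (locallyLipschitzOn_real_mul
    (locallyLipschitzOn_real_mul (locallyLipschitzOn_real_mul hcL hψ) hwL) hwL)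
    (hsupp _).1 (hsupp _).2
  obtain ⟨iE, eE⟩ := setIntegral_fderiv_eq_zero hD (locallyLipschitzOn_real_mul
    (locallyLipschitzOn_real_mul hgL hwL) hwL) (hsupp _).1 (hsupp _).2 (0, 1)
  have h1 : ∫ p in D, b p / √(1 + b p ^ 2) * L p = 0 := by
    rw [← eA]
    refine integral_congr_ae ?_
    filter_upwards [hbd, hBb] with p hbp hBbp
    have hg := (hasDerivAt_div_sqrt_one_add_sq (b p)).comp_hasFDerivAt p hbp.hasFDerivAt
    have hf := (hg.mul (hwd p).hasFDerivAt).fderiv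
    simp only [Function.comp_def, Pi.mul_def] at hf
    rw [hf]
    simp only [add_apply, smul_apply, smul_eq_mul, hBbp, hL]
    ring
  set Q : ℝ × ℝ → ℝ := fun p => b p / √(1 + b p ^ 2) * M p + L p ^ 2 / (2 * √(1 + b p ^ 2) ^ 3)
    with hQ
  have iQ : IntegrableOn Q D := integrable_second_variation hbm hLm hMm hLC hMC
  set P : ℝ × ℝ → ℝ := fun p => 4 * fderiv ℝ b p (0, 1)
    - (fderiv ℝ ψ p (1, 0) - 4 * u p * fderiv ℝ ψ p (0, 1))
    - 4 * fderiv ℝ u p (0, 1) * ψ p - ψ p ^ 2 with hP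
  have key : ∀ᵐ p ∂(volume.restrict D), 2 * Q p
      + 4 * fderiv ℝ (fun p => b p / √(1 + b p ^ 2) * w p * w p) p (0, 1)
      - (fderiv ℝ (fun p => 1 / √(1 + b p ^ 2) ^ 3 * ψ p * w p * w p) p (1, 0)
        - 4 * u p * fderiv ℝ (fun p => 1 / √(1 + b p ^ 2) ^ 3 * ψ p * w p * w p) p (0, 1)
        - 4 * fderiv ℝ u p (0, 1) * (1 / √(1 + b p ^ 2) ^ 3 * ψ p * w p * w p))
      = 1 / √(1 + b p ^ 2) ^ 3 * ((L p - ψ p * w p) ^ 2 + P p * w p ^ 2) := by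
    filter_upwards [hbd, hψd, hBb] with p hbp hψp hBbp
    have hg := (hasDerivAt_div_sqrt_one_add_sq (b p)).comp_hasFDerivAt p hbp.hasFDerivAt
    have hf := ((hg.mul (hwd p).hasFDerivAt).mul (hwd p).hasFDerivAt).fderiv
    have hc := ((contDiff_inv_sqrt_one_add_sq_pow.differentiable one_ne_zero
      (b p)).hasDerivAt).comp_hasFDerivAt p hbp.hasFDerivAt
    have hf' := (((hc.mul hψp.hasFDerivAt).mul (hwd p).hasFDerivAt).mul (hwd p).hasFDerivAt).fderiv
    simp only [Function.comp_def, Pi.mul_def] at hf hf'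
    rw [hf, hf']
    simp only [add_apply, smul_apply, smul_eq_mul, hBbp, hL, hP, hQ, hM]
    ring
  have h2 : 0 < ∫ p in D, Q p := by
    have iJ := ((iQ.const_mul 2).add (iE.const_mul 4)).sub iB
    have eJ := integral_sub ((iQ.const_mul 2).add (iE.const_mul 4)) iB
    have eJ' := integral_add (iQ.const_mul 2) (iE.const_mul 4)
    simp only [Pi.add_apply] at eJ
    rw [eJ', integral_const_mul, integral_const_mul, eE, eB] at eJ
    rw [integral_congr_ae key] at eJ
    have iJ' := iJ.congr key
    have hnn : 0 ≤ᵐ[volume.restrict D] fun p =>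
        1 / √(1 + b p ^ 2) ^ 3 * ((L p - ψ p * w p) ^ 2 + P p * w p ^ 2) := by
      filter_upwards [hric] with p hp
      have : 0 < P p := hp
      simp only [Pi.zero_apply]
      positivity
    have hge := integral_nonneg_of_ae hnn
    rcases hge.lt_or_eq with h | h
    · linarith
    exfalso
    have hz := (integral_eq_zero_iff_of_nonneg_ae hnn iJ').1 h.symm
    have hv : ∀ᵐ p ∂(volume.restrict D), w p = 0 := by
      filter_upwards [hz, hric] with p hp hr
      have hPp : 0 < P p := hr
      have hr0 : 0 < 1 / √(1 + b p ^ 2) ^ 3 := by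
        have := one_le_sqrt_one_add_sq (b p); positivity
      by_contra hne
      have : 0 < 1 / √(1 + b p ^ 2) ^ 3 * ((L p - ψ p * w p) ^ 2 + P p * w p ^ 2) := by
        positivity
      exact this.ne' hp
    rw [ae_restrict_iff' hD.measurableSet, ae_iff] at hv
    have hopen : IsOpen (D ∩ {p | w p ≠ 0}) :=
      hD.inter (isOpen_ne_fun hw1.continuous continuous_const)
    have hpos := hopen.measure_pos volume ⟨p₀, hws (subset_tsupport _ hp₀), hp₀⟩
    refine hpos.ne' (measure_mono_null ?_ hv)
    rintro p ⟨hpD, hpw⟩ h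
    exact hpw (h hpD)
  obtain ⟨r1, ε₀, hε₀, r2⟩ := hasDerivAt_and_le_of_second_variation hC hbm hLm hMm hbC hLC hMC h1 h2
  have hF : ∀ ε : ℝ, ∫ p in D, √(1 + (b p + ε * L p + ε ^ 2 * M p) ^ 2)
      = ∫ p in D, √(1 + ((fderiv ℝ u p (1, 0) + ε * fderiv ℝ w p (1, 0))
        - 4 * (u p + ε * w p) * (fderiv ℝ u p (0, 1) + ε * fderiv ℝ w p (0, 1))) ^ 2) := by
    intro ε
    refine integral_congr_ae ?_
    filter_upwards [hBu] with p hp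
    congr 3
    rw [← hp]
    simp only [hL, hM]
    ring
  have hF0 : ∫ p in D, √(1 + b p ^ 2)
      = ∫ p in D, √(1 + (fderiv ℝ u p (1, 0) - 4 * u p * fderiv ℝ u p (0, 1)) ^ 2) := by
    refine integral_congr_ae ?_
    filter_upwards [hBu] with p hp
    rw [hp]
  simp only [hF, hF0] at r1 r2
  exact ⟨r1, ε₀, hε₀, r2⟩

lemma DifferentiableAt.hasDerivAt_add_smul {f : ℝ × ℝ → ℝ} {p : ℝ × ℝ}
    (hf : DifferentiableAt ℝ f p) (v : ℝ × ℝ) :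
    HasDerivAt (fun s : ℝ => f (p + s • v)) (fderiv ℝ f p v) 0 :=
  hf.hasFDerivAt.hasLineDerivAt v

lemma differentiableAt_real_div {f g : ℝ × ℝ → ℝ} {p : ℝ × ℝ} (hf : DifferentiableAt ℝ f p)
    (hg : DifferentiableAt ℝ g p) (h0 : g p ≠ 0) : DifferentiableAt ℝ (fun q => f q / g q) p := by
  simp only [div_eq_mul_inv]
  exact hf.fun_mul (hg.fun_inv h0)

/-- A function which is constant along a curve through `p` with velocity `(1, c)` is transported
with speed `c`. -/
lemma fderiv_fst_eq_of_eventually_const {f : ℝ × ℝ → ℝ} {p : ℝ × ℝ} {τ : ℝ → ℝ} {c : ℝ}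
    (hf : DifferentiableAt ℝ f p) (h0 : τ p.1 = p.2) (hτ : HasDerivAt τ c p.1)
    (hc : ∀ᶠ y in 𝓝 p.1, f (y, τ y) = f p) :
    fderiv ℝ f p (1, 0) = -c * fderiv ℝ f p (0, 1) := by
  have hpt : (p.1, τ p.1) = p := by rw [h0]
  have hcurve : HasDerivAt (fun y => (y, τ y)) ((1 : ℝ), c) p.1 := (hasDerivAt_id' _).prodMk hτ
  have hf' : HasFDerivAt f (fderiv ℝ f p) (p.1, τ p.1) := by rw [hpt]; exact hf.hasFDerivAt
  have h1 := hf'.comp_hasDerivAt p.1 hcurve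
  have h2 : HasDerivAt (f ∘ fun y => (y, τ y)) 0 p.1 :=
    (hasDerivAt_const p.1 (f p)).congr_of_eventuallyEq hc
  have h3 := h1.unique h2
  have h4 : ((1 : ℝ), c) = (1, 0) + c • ((0 : ℝ), (1 : ℝ)) := by simp
  rw [h4, map_add, map_smul, smul_eq_mul] at h3
  linarith

lemma abs_fderiv_snd_le_of_eventually {f : ℝ × ℝ → ℝ} {p : ℝ × ℝ} {C : ℝ} (hC : 0 ≤ C)
    (hf : DifferentiableAt ℝ f p)
    (h : ∀ᶠ t in 𝓝 p.2, |f (p.1, t) - f p| ≤ C * |t - p.2|) :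
    |fderiv ℝ f p (0, 1)| ≤ C := by
  have hcurve : HasDerivAt (fun t => (p.1, t)) ((0 : ℝ), (1 : ℝ)) p.2 :=
    (hasDerivAt_const _ _).prodMk (hasDerivAt_id' _)
  have h1 := (hf.hasFDerivAt (x := (p.1, p.2))).comp_hasDerivAt p.2 hcurve
  exact h1.le_of_lip' hC h

lemma riccati_pos {y g₁ g₂ f₁ f₂ g₁' g₂' f₁' f₂' b' u' Mg Mf Cg Cf : ℝ}
    (hsmall : 24 * (Mg * Cf + Mf * Cg) < 1) (hlt₁ : g₁ < y) (hlt₂ : y < g₂)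
    (hg₁ : |g₁| ≤ Mg) (hg₂ : |g₂| ≤ Mg) (hf₁ : |f₁| ≤ Mf) (hf₂ : |f₂| ≤ Mf)
    (tg₁ : |g₁'| ≤ Cg) (tg₂ : |g₂'| ≤ Cg) (tf₁ : |f₁'| ≤ Cf) (tf₂ : |f₂'| ≤ Cf)
    (hb : b' * (g₂ - g₁) ^ 2 = (f₂' - f₁') * (g₂ - g₁) - (f₂ - f₁) * (g₂' - g₁'))
    (hu : u' * (g₂ - g₁) ^ 2 = (g₂ - g₁) * (f₁' * (g₂ - y) + f₂' * (y - g₁))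
      - (f₂ - f₁) * ((y - g₁) * g₂' + (g₂ - y) * g₁')) :
    0 < 4 * b' - -2 / (g₂ - g₁) ^ 2 - 4 * u' * ((g₁ + g₂ - 2 * y) / (g₂ - g₁) ^ 2)
      - ((g₁ + g₂ - 2 * y) / (g₂ - g₁) ^ 2) ^ 2 := by
  have hl : 0 < g₂ - g₁ := by linarith
  have hlM : g₂ - g₁ ≤ 2 * Mg := by
    have := abs_le.1 hg₁; have := abs_le.1 hg₂; linarith
  have hCf : 0 ≤ Cf := (abs_nonneg _).trans tf₁
  have hδ : |f₂ - f₁| ≤ 2 * Mf := (abs_sub _ _).trans (by linarith)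
  have hlC : (g₂ - g₁) * Cf ≤ 2 * Mg * Cf := by gcongr
  have hbl : |b' * (g₂ - g₁) ^ 2| ≤ 4 * (Mg * Cf + Mf * Cg) := by
    rw [hb]
    refine (abs_sub _ _).trans ?_
    rw [abs_mul, abs_mul, abs_of_pos hl]
    have h1 : |f₂' - f₁'| * (g₂ - g₁) ≤ (2 * Cf) * (g₂ - g₁) := by
      gcongr; exact (abs_sub _ _).trans (by linarith)
    have h2 : |f₂ - f₁| * |g₂' - g₁'| ≤ (2 * Mf) * (2 * Cg) :=
      mul_le_mul hδ ((abs_sub _ _).trans (by linarith)) (abs_nonneg _) ((abs_nonneg _).trans hδ)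
    linarith
  have hul : |u'| * (g₂ - g₁) ≤ 2 * (Mg * Cf + Mf * Cg) := by
    refine le_of_mul_le_mul_right ?_ hl
    have e : |u'| * (g₂ - g₁) * (g₂ - g₁) = |u' * (g₂ - g₁) ^ 2| := by
      rw [abs_mul, abs_of_pos (by positivity : 0 < (g₂ - g₁) ^ 2)]; ring
    rw [e, hu]
    refine (abs_sub _ _).trans ?_
    rw [abs_mul, abs_mul, abs_of_pos hl]
    have ha : 0 ≤ g₂ - y := by linarith
    have hc : 0 ≤ y - g₁ := by linarith
    have h1 : |f₁' * (g₂ - y) + f₂' * (y - g₁)| ≤ Cf * (g₂ - g₁) := by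
      refine (abs_add_le _ _).trans ?_
      rw [abs_mul, abs_mul, abs_of_nonneg ha, abs_of_nonneg hc]
      nlinarith
    have h2 : |(y - g₁) * g₂' + (g₂ - y) * g₁'| ≤ Cg * (g₂ - g₁) := by
      refine (abs_add_le _ _).trans ?_
      rw [abs_mul, abs_mul, abs_of_nonneg ha, abs_of_nonneg hc]
      nlinarith
    have h3 : (g₂ - g₁) * |f₁' * (g₂ - y) + f₂' * (y - g₁)| ≤ (g₂ - g₁) * (Cf * (g₂ - g₁)) := by
      gcongr
    have h4 : |f₂ - f₁| * |(y - g₁) * g₂' + (g₂ - y) * g₁'| ≤ (2 * Mf) * (Cg * (g₂ - g₁)) := by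
      gcongr
      exact (abs_nonneg _).trans hδ
    have h5 : (g₂ - g₁) * (Cf * (g₂ - g₁)) ≤ 2 * Mg * Cf * (g₂ - g₁) := by nlinarith
    linarith
  have hn : |g₁ + g₂ - 2 * y| ≤ g₂ - g₁ := abs_le.2 ⟨by linarith, by linarith⟩
  have hun : |u' * (g₁ + g₂ - 2 * y)| ≤ 2 * (Mg * Cf + Mf * Cg) := by
    rw [abs_mul]
    exact le_trans (by gcongr) hul
  have hn2 : (g₁ + g₂ - 2 * y) ^ 2 / (g₂ - g₁) ^ 2 ≤ 1 := by
    rw [div_le_one (by positivity)]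
    exact sq_le_sq' (by linarith) (by linarith)
  have h1 := (abs_le.1 hbl).1
  have h2 := (abs_le.1 hun).2
  have key : 0 < (4 * (b' * (g₂ - g₁) ^ 2) + 2 - 4 * (u' * (g₁ + g₂ - 2 * y))
      - (g₁ + g₂ - 2 * y) ^ 2 / (g₂ - g₁) ^ 2) / (g₂ - g₁) ^ 2 := by
    apply div_pos _ (by positivity)
    linarith
  refine key.trans_eq ?_
  field_simp
  ring

/-- Derivatives of the functions attached to a ruling: if `u` is the affine interpolation between
the values `f₁` at `g₁` and `f₂` at `g₂`, and these data are transported by `∂_y - 4u∂_t`, then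
`Bu = b` and `Bb = 0` with `b` the slope, and the function `ψ = -(2y - g₁ - g₂)/(g₂ - g₁)²`
satisfies the Riccati inequality. -/
lemma riccati_pointwise {u g₁ g₂ f₁ f₂ : ℝ × ℝ → ℝ} {p : ℝ × ℝ} {Mg Mf Cg Cf : ℝ}
    (hsmall : 24 * (Mg * Cf + Mf * Cg) < 1)
    (dg₁ : DifferentiableAt ℝ g₁ p) (dg₂ : DifferentiableAt ℝ g₂ p)
    (df₁ : DifferentiableAt ℝ f₁ p) (df₂ : DifferentiableAt ℝ f₂ p)
    (hlt₁ : g₁ p < p.1) (hlt₂ : p.1 < g₂ p)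
    (hg₁ : |g₁ p| ≤ Mg) (hg₂ : |g₂ p| ≤ Mg) (hf₁ : |f₁ p| ≤ Mf) (hf₂ : |f₂ p| ≤ Mf)
    (hu : u =ᶠ[𝓝 p] fun q => (f₁ q * (g₂ q - q.1) + f₂ q * (q.1 - g₁ q)) / (g₂ q - g₁ q))
    (yg₁ : fderiv ℝ g₁ p (1, 0) = 4 * u p * fderiv ℝ g₁ p (0, 1))
    (yg₂ : fderiv ℝ g₂ p (1, 0) = 4 * u p * fderiv ℝ g₂ p (0, 1))
    (yf₁ : fderiv ℝ f₁ p (1, 0) = 4 * u p * fderiv ℝ f₁ p (0, 1))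
    (yf₂ : fderiv ℝ f₂ p (1, 0) = 4 * u p * fderiv ℝ f₂ p (0, 1))
    (tg₁ : |fderiv ℝ g₁ p (0, 1)| ≤ Cg) (tg₂ : |fderiv ℝ g₂ p (0, 1)| ≤ Cg)
    (tf₁ : |fderiv ℝ f₁ p (0, 1)| ≤ Cf) (tf₂ : |fderiv ℝ f₂ p (0, 1)| ≤ Cf) :
    let b : ℝ × ℝ → ℝ := fun q => (f₂ q - f₁ q) / (g₂ q - g₁ q)
    let ψ : ℝ × ℝ → ℝ := fun q => (g₁ q + g₂ q - 2 * q.1) / (g₂ q - g₁ q) ^ 2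
    fderiv ℝ u p (1, 0) - 4 * u p * fderiv ℝ u p (0, 1) = b p ∧
    fderiv ℝ b p (1, 0) = 4 * u p * fderiv ℝ b p (0, 1) ∧
    0 < 4 * fderiv ℝ b p (0, 1) - (fderiv ℝ ψ p (1, 0) - 4 * u p * fderiv ℝ ψ p (0, 1))
        - 4 * fderiv ℝ u p (0, 1) * ψ p - ψ p ^ 2 := by
  intro b ψ
  have hl : 0 < g₂ p - g₁ p := by linarith
  have dfst : DifferentiableAt ℝ (fun q : ℝ × ℝ => q.1) p := differentiableAt_fst
  have db : DifferentiableAt ℝ b p :=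
    differentiableAt_real_div (df₂.fun_sub df₁) (dg₂.fun_sub dg₁) hl.ne'
  have dψ : DifferentiableAt ℝ ψ p :=
    differentiableAt_real_div ((dg₁.fun_add dg₂).fun_sub (dfst.const_mul 2))
      ((dg₂.fun_sub dg₁).fun_pow 2) (pow_ne_zero 2 hl.ne')
  set U : ℝ × ℝ → ℝ := fun q => (f₁ q * (g₂ q - q.1) + f₂ q * (q.1 - g₁ q)) / (g₂ q - g₁ q)
    with hU
  have dU : DifferentiableAt ℝ U p :=
    differentiableAt_real_div ((df₁.fun_mul (dg₂.fun_sub dfst)).fun_add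
      (df₂.fun_mul (dfst.fun_sub dg₁))) (dg₂.fun_sub dg₁) hl.ne'
  have hup : u p = U p := hu.eq_of_nhds
  rw [hu.fderiv_eq]
  have hfst : ∀ v : ℝ × ℝ, HasDerivAt (fun s : ℝ => (p + s • v).1) v.1 0 := fun v => by
    simpa using ((hasDerivAt_id' (0 : ℝ)).mul_const v.1).const_add p.1
  have hl0' : ∀ v : ℝ × ℝ, g₂ (p + (0 : ℝ) • v) - g₁ (p + (0 : ℝ) • v) ≠ 0 := fun v => by
    simpa using hl.ne'
  have eb : ∀ v, fderiv ℝ b p v = _ := fun v => (db.hasDerivAt_add_smul v).unique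
    (((df₂.hasDerivAt_add_smul v).sub (df₁.hasDerivAt_add_smul v)).fun_div
      ((dg₂.hasDerivAt_add_smul v).sub (dg₁.hasDerivAt_add_smul v)) (hl0' v))
  have eψ : ∀ v, fderiv ℝ ψ p v = _ := fun v => (dψ.hasDerivAt_add_smul v).unique
    ((((dg₁.hasDerivAt_add_smul v).add (dg₂.hasDerivAt_add_smul v)).sub
      ((hfst v).const_mul 2)).fun_div
      (((dg₂.hasDerivAt_add_smul v).sub (dg₁.hasDerivAt_add_smul v)).pow 2)
      (pow_ne_zero 2 (hl0' v)))
  have eU : ∀ v, fderiv ℝ U p v = _ := fun v => (dU.hasDerivAt_add_smul v).unique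
    ((((df₁.hasDerivAt_add_smul v).mul ((dg₂.hasDerivAt_add_smul v).sub (hfst v))).add
      ((df₂.hasDerivAt_add_smul v).mul ((hfst v).sub (dg₁.hasDerivAt_add_smul v)))).fun_div
      ((dg₂.hasDerivAt_add_smul v).sub (dg₁.hasDerivAt_add_smul v)) (hl0' v))
  simp only [zero_smul, add_zero, Pi.sub_apply, Pi.add_apply, Pi.mul_apply] at eb eψ eU
  have hBψ : fderiv ℝ ψ p (1, 0) - 4 * u p * fderiv ℝ ψ p (0, 1) = -2 / (g₂ p - g₁ p) ^ 2 := by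
    rw [eψ, eψ, yg₁, yg₂]
    field_simp
    ring
  have hbt : fderiv ℝ b p (0, 1) * (g₂ p - g₁ p) ^ 2
      = (fderiv ℝ f₂ p (0, 1) - fderiv ℝ f₁ p (0, 1)) * (g₂ p - g₁ p)
        - (f₂ p - f₁ p) * (fderiv ℝ g₂ p (0, 1) - fderiv ℝ g₁ p (0, 1)) := by
    rw [eb]
    field_simp
  have hUt : fderiv ℝ U p (0, 1) * (g₂ p - g₁ p) ^ 2
      = (g₂ p - g₁ p) * (fderiv ℝ f₁ p (0, 1) * (g₂ p - p.1) + fderiv ℝ f₂ p (0, 1) * (p.1 - g₁ p))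
        - (f₂ p - f₁ p) * ((p.1 - g₁ p) * fderiv ℝ g₂ p (0, 1)
          + (g₂ p - p.1) * fderiv ℝ g₁ p (0, 1)) := by
    rw [eU]
    field_simp
    ring
  refine ⟨?_, ?_, ?_⟩
  · simp only [eU, yg₁, yg₂, yf₁, yf₂, b]
    field_simp
    ring
  · simp only [eb, yg₁, yg₂, yf₁, yf₂]
    field_simp
  rw [hBψ]
  exact riccati_pos hsmall hlt₁ hlt₂ hg₁ hg₂ hf₁ hf₂ tg₁ tg₂ tf₁ tf₂ hbt hUt

/-- Ruled solutions with small data satisfy the Riccati inequality of the second variation almost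
everywhere. -/
theorem exists_riccati_of_ruling {D : Set (ℝ × ℝ)} (hD : IsOpen D) {u g₁ g₂ f₁ f₂ : ℝ × ℝ → ℝ}
    {Mg Mf Cg Cf : ℝ} (hsmall : 24 * (Mg * Cf + Mf * Cg) < 1) (hCg : 0 ≤ Cg) (hCf : 0 ≤ Cf)
    (lg₁ : LocallyLipschitzOn D g₁) (lg₂ : LocallyLipschitzOn D g₂)
    (lf₁ : LocallyLipschitzOn D f₁) (lf₂ : LocallyLipschitzOn D f₂)
    (hlt : ∀ p ∈ D, g₁ p < p.1 ∧ p.1 < g₂ p)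
    (hg : ∀ p ∈ D, |g₁ p| ≤ Mg ∧ |g₂ p| ≤ Mg) (hf : ∀ p ∈ D, |f₁ p| ≤ Mf ∧ |f₂ p| ≤ Mf)
    (hu : ∀ p ∈ D, u p = (f₁ p * (g₂ p - p.1) + f₂ p * (p.1 - g₁ p)) / (g₂ p - g₁ p))
    (hchar : ∀ p ∈ D, ∃ τ : ℝ → ℝ, τ p.1 = p.2 ∧ HasDerivAt τ (-4 * u p) p.1 ∧
      ∀ᶠ y in 𝓝 p.1, g₁ (y, τ y) = g₁ p ∧ g₂ (y, τ y) = g₂ p ∧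
        f₁ (y, τ y) = f₁ p ∧ f₂ (y, τ y) = f₂ p)
    (hvert : ∀ p ∈ D, ∀ᶠ t in 𝓝 p.2,
      |g₁ (p.1, t) - g₁ p| ≤ Cg * |t - p.2| ∧ |g₂ (p.1, t) - g₂ p| ≤ Cg * |t - p.2| ∧
      |f₁ (p.1, t) - f₁ p| ≤ Cf * |t - p.2| ∧ |f₂ (p.1, t) - f₂ p| ≤ Cf * |t - p.2|) :
    ∃ b ψ : ℝ × ℝ → ℝ, LocallyLipschitzOn D b ∧ LocallyLipschitzOn D ψ ∧
      ∀ᵐ p ∂(volume.restrict D),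
        fderiv ℝ u p (1, 0) - 4 * u p * fderiv ℝ u p (0, 1) = b p ∧
        fderiv ℝ b p (1, 0) = 4 * u p * fderiv ℝ b p (0, 1) ∧
        0 < 4 * fderiv ℝ b p (0, 1) - (fderiv ℝ ψ p (1, 0) - 4 * u p * fderiv ℝ ψ p (0, 1))
          - 4 * fderiv ℝ u p (0, 1) * ψ p - ψ p ^ 2 := by
  have hl : ∀ p ∈ D, g₂ p - g₁ p ≠ 0 := fun p hp => by
    have := hlt p hp
    exact (by linarith : 0 < g₂ p - g₁ p).ne'
  have lid : LocallyLipschitzOn D fun q : ℝ × ℝ => 2 * q.1 :=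
    (by fun_prop : ContDiff ℝ 1 fun q : ℝ × ℝ => 2 * q.1).locallyLipschitz.locallyLipschitzOn
  refine ⟨fun q => (f₂ q - f₁ q) / (g₂ q - g₁ q),
    fun q => (g₁ q + g₂ q - 2 * q.1) / (g₂ q - g₁ q) ^ 2,
    locallyLipschitzOn_real_div (lf₂.sub lf₁) (lg₂.sub lg₁) hl,
    locallyLipschitzOn_real_div ((lg₁.add lg₂).sub lid)
      (by simpa only [sq] using locallyLipschitzOn_real_mul (lg₂.sub lg₁) (lg₂.sub lg₁))
      fun p hp => pow_ne_zero 2 (hl p hp), ?_⟩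
  filter_upwards [ae_restrict_mem hD.measurableSet,
    ae_differentiableAt_of_locallyLipschitzOn volume hD lg₁,
    ae_differentiableAt_of_locallyLipschitzOn volume hD lg₂,
    ae_differentiableAt_of_locallyLipschitzOn volume hD lf₁,
    ae_differentiableAt_of_locallyLipschitzOn volume hD lf₂] with p hp dg₁ dg₂ df₁ df₂
  obtain ⟨τ, h0, hτ, hc⟩ := hchar p hp
  have hv := hvert p hp
  have htr : ∀ f : ℝ × ℝ → ℝ, DifferentiableAt ℝ f p → (∀ᶠ y in 𝓝 p.1, f (y, τ y) = f p) →
      fderiv ℝ f p (1, 0) = 4 * u p * fderiv ℝ f p (0, 1) := fun f hf h => by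
    rw [fderiv_fst_eq_of_eventually_const hf h0 hτ h]; ring
  exact riccati_pointwise hsmall dg₁ dg₂ df₁ df₂ (hlt p hp).1 (hlt p hp).2 (hg p hp).1 (hg p hp).2
    (hf p hp).1 (hf p hp).2 (Filter.eventually_of_mem (hD.mem_nhds hp) hu)
    (htr _ dg₁ (hc.mono fun _ h => h.1)) (htr _ dg₂ (hc.mono fun _ h => h.2.1))
    (htr _ df₁ (hc.mono fun _ h => h.2.2.1)) (htr _ df₂ (hc.mono fun _ h => h.2.2.2))
    (abs_fderiv_snd_le_of_eventually hCg dg₁ (hv.mono fun _ h => h.1))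
    (abs_fderiv_snd_le_of_eventually hCg dg₂ (hv.mono fun _ h => h.2.1))
    (abs_fderiv_snd_le_of_eventually hCf df₁ (hv.mono fun _ h => h.2.2.1))
    (abs_fderiv_snd_le_of_eventually hCf df₂ (hv.mono fun _ h => h.2.2.2))

/-- The boundary data of a ruled graph over the lens `γ₁ < y < γ₂`, with the products of the sizes
and Lipschitz constants of the `γᵢ` and the `φᵢ` small. -/
structure SmallRuling (tb : ℝ) (γ₁ γ₂ φ₁ φ₂ lam : ℝ → ℝ) (Mγ Lγ Mφ Lφ : NNReal) : Prop where
  γ₁_lip : LipschitzOnWith Lγ γ₁ (Icc 0 tb)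
  γ₂_lip : LipschitzOnWith Lγ γ₂ (Icc 0 tb)
  φ₁_lip : LipschitzOnWith Lφ φ₁ (Icc 0 tb)
  φ₂_lip : LipschitzOnWith Lφ φ₂ (Icc 0 tb)
  γ₁_bd : ∀ s ∈ Icc 0 tb, |γ₁ s| ≤ (Mγ : ℝ)
  γ₂_bd : ∀ s ∈ Icc 0 tb, |γ₂ s| ≤ (Mγ : ℝ)
  φ₁_bd : ∀ s ∈ Icc 0 tb, |φ₁ s| ≤ (Mφ : ℝ)
  φ₂_bd : ∀ s ∈ Icc 0 tb, |φ₂ s| ≤ (Mφ : ℝ)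
  sign : ∀ t ∈ Ioo 0 tb, γ₁ t < 0 ∧ 0 < γ₂ t
  small : 100 * ((Mγ : ℝ) * Lφ + Mφ * Lγ) ≤ 1
  mapsTo : MapsTo lam (Icc 0 tb) (Icc 0 tb)
  mapsTo_Ioo : MapsTo lam (Ioo 0 tb) (Ioo 0 tb)
  sol : ∀ s ∈ Icc 0 tb, Qphi γ₁ γ₂ φ₁ φ₂ s (lam s) = 0

/-- The value at height `y` of the line through `(γ₁ s, φ₁ s)` and `(γ₂ (λ s), φ₂ (λ s))`. -/
def rulingVal (γ₁ γ₂ φ₁ φ₂ lam : ℝ → ℝ) (y s : ℝ) : ℝ :=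
  φ₁ s + (φ₂ (lam s) - φ₁ s) * ((y - γ₁ s) / (γ₂ (lam s) - γ₁ s))

/-- The projection to the `(y,t)` plane of the `s`-th ruling, as a curve `t = τ(y, s)`. -/
def rulingTau (γ₁ γ₂ φ₁ φ₂ lam : ℝ → ℝ) (y s : ℝ) : ℝ :=
  s - 2 * (φ₁ s + rulingVal γ₁ γ₂ φ₁ φ₂ lam y s) * (y - γ₁ s)

lemma LipschitzOnWith.abs_sub_le {K : NNReal} {f : ℝ → ℝ} {A : Set ℝ} (hf : LipschitzOnWith K f A)
    {x y : ℝ} (hx : x ∈ A) (hy : y ∈ A) : |f x - f y| ≤ K * |x - y| := by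
  simpa [Real.dist_eq] using hf.dist_le_mul x hx y hy

lemma abs_mul_sub_mul_le {a b a' b' A B α β : ℝ} (ha : |a' - a| ≤ α) (hb' : |b'| ≤ B)
    (ha' : |a| ≤ A) (hb : |b' - b| ≤ β) : |a' * b' - a * b| ≤ α * B + A * β := by
  have e : a' * b' - a * b = (a' - a) * b' + a * (b' - b) := by ring
  rw [e]
  refine (abs_add_le _ _).trans ?_
  rw [abs_mul, abs_mul]
  have h1 : 0 ≤ α := (abs_nonneg _).trans ha
  have h2 : 0 ≤ A := (abs_nonneg _).trans ha'
  gcongr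

/-- The function `(Y, ℓ) ↦ Y²/ℓ` is Lipschitz on `0 < Y < ℓ`. -/
lemma abs_sq_div_sub_sq_div_le {Y l Y' l' : ℝ} (hY : 0 < Y) (hYl : Y < l) (hY' : 0 < Y')
    (hYl' : Y' < l') : |Y' ^ 2 / l' - Y ^ 2 / l| ≤ 2 * |Y' - Y| + |l' - l| := by
  have hl : 0 < l := hY.trans hYl
  have hl' : 0 < l' := hY'.trans hYl'
  have e : Y' ^ 2 / l' - Y ^ 2 / l
      = (Y' / l' + Y / l) * (Y' - Y) - (Y' / l') * (Y / l) * (l' - l) := by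
    field_simp
    ring
  have h1 : Y / l ≤ 1 := (div_le_one hl).2 hYl.le
  have h1' : Y' / l' ≤ 1 := (div_le_one hl').2 hYl'.le
  have h0 : 0 < Y / l := by positivity
  have h0' : 0 < Y' / l' := by positivity
  rw [e]
  refine (abs_sub _ _).trans ?_
  rw [abs_mul, abs_mul, abs_of_pos (by positivity : 0 < Y' / l' + Y / l),
    abs_of_pos (by positivity : 0 < Y' / l' * (Y / l))]
  have h2 : Y' / l' * (Y / l) ≤ 1 := mul_le_one₀ h1' h0.le h1
  have h3 : Y' / l' * (Y / l) * |l' - l| ≤ 1 * |l' - l| := by gcongr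
  have h4 : (Y' / l' + Y / l) * |Y' - Y| ≤ 2 * |Y' - Y| := by gcongr; linarith
  linarith

namespace SmallRuling

variable {tb : ℝ} {γ₁ γ₂ φ₁ φ₂ lam : ℝ → ℝ} {Mγ Lγ Mφ Lφ : NNReal}

lemma abs_lam_sub_le (H : SmallRuling tb γ₁ γ₂ φ₁ φ₂ lam Mγ Lγ Mφ Lφ) {s s' : ℝ}
    (hs : s ∈ Icc 0 tb) (hs' : s' ∈ Icc 0 tb) : |lam s' - lam s| ≤ 11 / 10 * |s' - s| := by
  have hl := H.mapsTo hs
  have hl' := H.mapsTo hs'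
  have q := H.sol s hs
  have q' := H.sol s' hs'
  simp only [Qphi] at q q'
  have h1 : |(γ₂ (lam s') - γ₁ s') - (γ₂ (lam s) - γ₁ s)| ≤ Lγ * (|lam s' - lam s| + |s' - s|) := by
    have e : (γ₂ (lam s') - γ₁ s') - (γ₂ (lam s) - γ₁ s)
      = (γ₂ (lam s') - γ₂ (lam s)) - (γ₁ s' - γ₁ s) := by ring
    rw [e]
    have := H.γ₂_lip.abs_sub_le hl' hl
    have := H.γ₁_lip.abs_sub_le hs' hs
    refine (abs_sub _ _).trans ?_
    linarith
  have h2 : |(φ₂ (lam s') + φ₁ s') - (φ₂ (lam s) + φ₁ s)| ≤ Lφ * (|lam s' - lam s| + |s' - s|) := by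
    have e : (φ₂ (lam s') + φ₁ s') - (φ₂ (lam s) + φ₁ s)
      = (φ₂ (lam s') - φ₂ (lam s)) + (φ₁ s' - φ₁ s) := by ring
    rw [e]
    have := H.φ₂_lip.abs_sub_le hl' hl
    have := H.φ₁_lip.abs_sub_le hs' hs
    refine (abs_add_le _ _).trans ?_
    linarith
  have h3 : |φ₂ (lam s') + φ₁ s'| ≤ 2 * Mφ := by
    have := H.φ₂_bd _ hl'; have := H.φ₁_bd _ hs'
    exact (abs_add_le _ _).trans (by linarith)
  have h4 : |γ₂ (lam s) - γ₁ s| ≤ 2 * Mγ := by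
    have := H.γ₂_bd _ hl; have := H.γ₁_bd _ hs
    exact (abs_sub _ _).trans (by linarith)
  have h5 := abs_mul_sub_mul_le h1 h3 h4 h2
  set X := |lam s' - lam s| + |s' - s| with hX
  have hX0 : 0 ≤ X := by positivity
  have h6 : Lγ * X * (2 * Mφ) + 2 * Mγ * (Lφ * X) ≤ 1 / 50 * X := by
    have := mul_le_mul_of_nonneg_right H.small hX0
    linarith
  have h7 : |lam s' - lam s| ≤ |s' - s| + 2 * (1 / 50 * X) := by
    have e : lam s' - lam s = (s' - s) - 2 * ((γ₂ (lam s') - γ₁ s') * (φ₂ (lam s') + φ₁ s')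
        - (γ₂ (lam s) - γ₁ s) * (φ₂ (lam s) + φ₁ s)) := by linear_combination q' - q
    rw [e]
    refine (abs_sub _ _).trans ?_
    rw [abs_mul, abs_two]
    linarith
  have := abs_nonneg (s' - s)
  linarith

lemma gap_pos (H : SmallRuling tb γ₁ γ₂ φ₁ φ₂ lam Mγ Lγ Mφ Lφ) {s : ℝ} (hs : s ∈ Ioo 0 tb) :
    0 < γ₂ (lam s) - γ₁ s := by
  have h1 := (H.sign s hs).1
  have h2 := (H.sign _ (H.mapsTo_Ioo hs)).2
  linarith

lemma gap_le (H : SmallRuling tb γ₁ γ₂ φ₁ φ₂ lam Mγ Lγ Mφ Lφ) {s : ℝ} (hs : s ∈ Icc 0 tb) :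
    γ₂ (lam s) - γ₁ s ≤ 2 * Mγ := by
  have h1 := abs_le.1 (H.γ₁_bd s hs)
  have h2 := abs_le.1 (H.γ₂_bd _ (H.mapsTo hs))
  linarith

/-- The family of rulings is almost vertically equidistant. -/
lemma abs_rulingTau_sub_sub_le (H : SmallRuling tb γ₁ γ₂ φ₁ φ₂ lam Mγ Lγ Mφ Lφ) {y s s' : ℝ}
    (hs : s ∈ Icc 0 tb) (hs' : s' ∈ Icc 0 tb) (hy : y ∈ Ioo (γ₁ s) (γ₂ (lam s)))
    (hy' : y ∈ Ioo (γ₁ s') (γ₂ (lam s'))) :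
    |rulingTau γ₁ γ₂ φ₁ φ₂ lam y s' - rulingTau γ₁ γ₂ φ₁ φ₂ lam y s - (s' - s)|
      ≤ 1 / 4 * |s' - s| := by
  have hl := H.mapsTo hs
  have hl' := H.mapsTo hs'
  have hlam := H.abs_lam_sub_le hs hs'
  have hLγ : (0 : ℝ) ≤ Lγ := Lγ.2
  have hLφ : (0 : ℝ) ≤ Lφ := Lφ.2
  set X := |s' - s| with hX
  have hX0 : 0 ≤ X := abs_nonneg _
  have d1 := H.γ₁_lip.abs_sub_le hs' hs
  have d2 : |γ₂ (lam s') - γ₂ (lam s)| ≤ Lγ * (11 / 10 * X) :=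
    (H.γ₂_lip.abs_sub_le hl' hl).trans (by gcongr)
  have d3 := H.φ₁_lip.abs_sub_le hs' hs
  have d4 : |φ₂ (lam s') - φ₂ (lam s)| ≤ Lφ * (11 / 10 * X) :=
    (H.φ₂_lip.abs_sub_le hl' hl).trans (by gcongr)
  have g := H.gap_le hs
  have g' := H.gap_le hs'
  have hY : |(y - γ₁ s') - (y - γ₁ s)| ≤ Lγ * X := by
    rw [show (y - γ₁ s') - (y - γ₁ s) = -(γ₁ s' - γ₁ s) by ring, abs_neg]; exact d1
  have hδ : |(φ₂ (lam s') - φ₁ s') - (φ₂ (lam s) - φ₁ s)| ≤ Lφ * (21 / 10 * X) := by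
    rw [show (φ₂ (lam s') - φ₁ s') - (φ₂ (lam s) - φ₁ s)
      = (φ₂ (lam s') - φ₂ (lam s)) - (φ₁ s' - φ₁ s) by ring]
    refine (abs_sub _ _).trans ?_
    linarith
  have hell : |(γ₂ (lam s') - γ₁ s') - (γ₂ (lam s) - γ₁ s)| ≤ Lγ * (21 / 10 * X) := by
    rw [show (γ₂ (lam s') - γ₁ s') - (γ₂ (lam s) - γ₁ s)
      = (γ₂ (lam s') - γ₂ (lam s)) - (γ₁ s' - γ₁ s) by ring]
    refine (abs_sub _ _).trans ?_
    linarith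
  have p1 : 0 < y - γ₁ s := by linarith [hy.1]
  have p1' : 0 < y - γ₁ s' := by linarith [hy'.1]
  have p2 : y - γ₁ s < γ₂ (lam s) - γ₁ s := by linarith [hy.2]
  have p2' : y - γ₁ s' < γ₂ (lam s') - γ₁ s' := by linarith [hy'.2]
  have hsq := abs_sq_div_sub_sq_div_le p1 p2 p1' p2'
  have hsq' : |(y - γ₁ s') ^ 2 / (γ₂ (lam s') - γ₁ s') - (y - γ₁ s) ^ 2 / (γ₂ (lam s) - γ₁ s)|
      ≤ Lγ * (41 / 10 * X) := by linarith
  have hsqb : |(y - γ₁ s') ^ 2 / (γ₂ (lam s') - γ₁ s')| ≤ 2 * Mγ := by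
    have h0 : 0 < γ₂ (lam s') - γ₁ s' := by linarith
    rw [abs_of_nonneg (by positivity), div_le_iff₀ h0]
    nlinarith
  have hYb : |y - γ₁ s'| ≤ 2 * Mγ := by rw [abs_of_pos p1']; linarith
  have hδb : |φ₂ (lam s) - φ₁ s| ≤ 2 * Mφ := by
    have := H.φ₂_bd _ hl; have := H.φ₁_bd _ hs
    exact (abs_sub _ _).trans (by linarith)
  have t1 := abs_mul_sub_mul_le d3 hYb (H.φ₁_bd s hs) hY
  have t2 := abs_mul_sub_mul_le hδ hsqb hδb hsq'
  have e : rulingTau γ₁ γ₂ φ₁ φ₂ lam y s' - rulingTau γ₁ γ₂ φ₁ φ₂ lam y s - (s' - s)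
      = -4 * (φ₁ s' * (y - γ₁ s') - φ₁ s * (y - γ₁ s))
        - 2 * ((φ₂ (lam s') - φ₁ s') * ((y - γ₁ s') ^ 2 / (γ₂ (lam s') - γ₁ s'))
          - (φ₂ (lam s) - φ₁ s) * ((y - γ₁ s) ^ 2 / (γ₂ (lam s) - γ₁ s))) := by
    simp only [rulingTau, rulingVal]
    ring
  rw [e]
  refine (abs_sub _ _).trans ?_
  rw [abs_mul, abs_mul, abs_neg, abs_two, abs_of_pos (by norm_num : (0 : ℝ) < 4)]
  have := mul_le_mul_of_nonneg_right H.small hX0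
  have k1 : 0 ≤ Mγ * Lφ * X := by positivity
  have k2 : 0 ≤ Mφ * Lγ * X := by positivity
  linarith

lemma abs_sub_le_of_rulingTau (H : SmallRuling tb γ₁ γ₂ φ₁ φ₂ lam Mγ Lγ Mφ Lφ) {y s s' : ℝ}
    (hs : s ∈ Icc 0 tb) (hs' : s' ∈ Icc 0 tb) (hy : y ∈ Ioo (γ₁ s) (γ₂ (lam s)))
    (hy' : y ∈ Ioo (γ₁ s') (γ₂ (lam s'))) :
    |s' - s| ≤ 4 / 3 * |rulingTau γ₁ γ₂ φ₁ φ₂ lam y s' - rulingTau γ₁ γ₂ φ₁ φ₂ lam y s| := by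
  have h := H.abs_rulingTau_sub_sub_le hs hs' hy hy'
  have h2 := abs_sub_abs_le_abs_sub (s' - s)
    (rulingTau γ₁ γ₂ φ₁ φ₂ lam y s' - rulingTau γ₁ γ₂ φ₁ φ₂ lam y s)
  rw [abs_sub_comm] at h
  linarith

lemma abs_rulingVal_le (H : SmallRuling tb γ₁ γ₂ φ₁ φ₂ lam Mγ Lγ Mφ Lφ) {y s : ℝ}
    (hs : s ∈ Icc 0 tb) (hy : y ∈ Ioo (γ₁ s) (γ₂ (lam s))) :
    |rulingVal γ₁ γ₂ φ₁ φ₂ lam y s| ≤ Mφ := by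
  have h1 := abs_le.1 (H.φ₁_bd s hs)
  have h2 := abs_le.1 (H.φ₂_bd _ (H.mapsTo hs))
  have hl : 0 < γ₂ (lam s) - γ₁ s := by linarith [hy.1, hy.2]
  have t0 : 0 ≤ (y - γ₁ s) / (γ₂ (lam s) - γ₁ s) := div_nonneg (by linarith [hy.1]) hl.le
  have t1 : (y - γ₁ s) / (γ₂ (lam s) - γ₁ s) ≤ 1 := (div_le_one hl).2 (by linarith [hy.2])
  simp only [rulingVal]
  rw [abs_le]
  constructor <;> nlinarith

lemma abs_rulingTau_sub_le (H : SmallRuling tb γ₁ γ₂ φ₁ φ₂ lam Mγ Lγ Mφ Lφ) {y y' s : ℝ}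
    (hs : s ∈ Icc 0 tb) (hy : y ∈ Ioo (γ₁ s) (γ₂ (lam s)))
    (hy' : y' ∈ Ioo (γ₁ s) (γ₂ (lam s))) :
    |rulingTau γ₁ γ₂ φ₁ φ₂ lam y' s - rulingTau γ₁ γ₂ φ₁ φ₂ lam y s| ≤ 4 * Mφ * |y' - y| := by
  have e : rulingTau γ₁ γ₂ φ₁ φ₂ lam y' s - rulingTau γ₁ γ₂ φ₁ φ₂ lam y s
      = -2 * (rulingVal γ₁ γ₂ φ₁ φ₂ lam y' s + rulingVal γ₁ γ₂ φ₁ φ₂ lam y s) * (y' - y) := by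
    simp only [rulingTau, rulingVal]
    ring
  rw [e, abs_mul]
  gcongr
  rw [abs_mul, abs_neg, abs_two]
  have := H.abs_rulingVal_le hs hy
  have := H.abs_rulingVal_le hs hy'
  have := abs_add_le (rulingVal γ₁ γ₂ φ₁ φ₂ lam y' s) (rulingVal γ₁ γ₂ φ₁ φ₂ lam y s)
  linarith

lemma hasDerivAt_rulingTau (y s : ℝ) :
    HasDerivAt (fun y => rulingTau γ₁ γ₂ φ₁ φ₂ lam y s) (-4 * rulingVal γ₁ γ₂ φ₁ φ₂ lam y s) y := by
  have hY : HasDerivAt (fun y => y - γ₁ s) 1 y := (hasDerivAt_id' y).sub_const _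
  have hV : HasDerivAt (fun y => rulingVal γ₁ γ₂ φ₁ φ₂ lam y s)
      ((φ₂ (lam s) - φ₁ s) * (1 / (γ₂ (lam s) - γ₁ s))) y :=
    ((hY.div_const _).const_mul _).const_add _
  have h := (((hV.const_add (φ₁ s)).const_mul 2).mul hY).const_sub s
  refine h.congr_deriv ?_
  simp only [rulingVal]
  ring

/-- A ruling through `(y, t)` leaves room to the left of `y` comparable to that of the lens. -/
lemma le_sub_left (H : SmallRuling tb γ₁ γ₂ φ₁ φ₂ lam Mγ Lγ Mφ Lφ) {y s t : ℝ}
    (hs : s ∈ Icc 0 tb) (ht : t ∈ Icc 0 tb) (hy : y ∈ Ioo (γ₁ s) (γ₂ (lam s)))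
    (hτ : rulingTau γ₁ γ₂ φ₁ φ₂ lam y s = t) : (y - γ₁ t) / 2 ≤ y - γ₁ s := by
  have hY : 0 < y - γ₁ s := by linarith [hy.1]
  have h1 : |t - s| ≤ 4 * Mφ * (y - γ₁ s) := by
    rw [← hτ, rulingTau, sub_sub_cancel_left, abs_neg, abs_mul, abs_of_pos hY]
    gcongr
    rw [abs_mul, abs_two]
    have := H.abs_rulingVal_le hs hy
    have := H.φ₁_bd s hs
    have := abs_add_le (φ₁ s) (rulingVal γ₁ γ₂ φ₁ φ₂ lam y s)
    linarith
  have h2 := H.γ₁_lip.abs_sub_le ht hs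
  have h3 : Lγ * |t - s| ≤ Lγ * (4 * Mφ * (y - γ₁ s)) := by gcongr
  have h4 := (abs_le.1 h2).1
  have h5 := mul_le_mul_of_nonneg_right H.small hY.le
  have h6 : 0 ≤ Mγ * Lφ * (y - γ₁ s) := by positivity
  linarith

/-- A ruling through `(y, t)` leaves room to the right of `y` comparable to that of the lens. -/
lemma le_sub_right (H : SmallRuling tb γ₁ γ₂ φ₁ φ₂ lam Mγ Lγ Mφ Lφ) {y s t : ℝ}
    (hs : s ∈ Icc 0 tb) (ht : t ∈ Icc 0 tb) (hy : y ∈ Ioo (γ₁ s) (γ₂ (lam s)))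
    (hτ : rulingTau γ₁ γ₂ φ₁ φ₂ lam y s = t) : (γ₂ t - y) / 2 ≤ γ₂ (lam s) - y := by
  have hY : 0 < γ₂ (lam s) - y := by linarith [hy.2]
  have hl : 0 < γ₂ (lam s) - γ₁ s := by linarith [hy.1, hy.2]
  have hlam := H.mapsTo hs
  have h1 : |t - lam s| ≤ 4 * Mφ * (γ₂ (lam s) - y) := by
    have e : t - lam s
        = 2 * (φ₂ (lam s) + rulingVal γ₁ γ₂ φ₁ φ₂ lam y s) * (γ₂ (lam s) - y) := by
      have q := H.sol s hs
      simp only [Qphi] at q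
      rw [← hτ]
      simp only [rulingTau, rulingVal]
      field_simp
      linear_combination (-(γ₂ (lam s) - γ₁ s)) * q
    rw [e, abs_mul, abs_of_pos hY]
    gcongr
    rw [abs_mul, abs_two]
    have := H.abs_rulingVal_le hs hy
    have := H.φ₂_bd _ hlam
    have := abs_add_le (φ₂ (lam s)) (rulingVal γ₁ γ₂ φ₁ φ₂ lam y s)
    linarith
  have h2 := H.γ₂_lip.abs_sub_le ht hlam
  have h3 : Lγ * |t - lam s| ≤ Lγ * (4 * Mφ * (γ₂ (lam s) - y)) := by gcongr
  have h4 := (abs_le.1 h2).2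
  have h5 := mul_le_mul_of_nonneg_right H.small hY.le
  have h6 : 0 ≤ Mγ * Lφ * (γ₂ (lam s) - y) := by positivity
  linarith

lemma isOpen_lensD (H : SmallRuling tb γ₁ γ₂ φ₁ φ₂ lam Mγ Lγ Mφ Lφ) :
    IsOpen (lensD γ₁ γ₂ tb) := by
  rw [isOpen_iff_mem_nhds]
  rintro p ⟨h0, h1, h2⟩
  have hI : Icc 0 tb ∈ 𝓝 p.2 := Icc_mem_nhds h0.1 h0.2
  have c1 : ContinuousAt (fun q : ℝ × ℝ => γ₁ q.2) p :=
    (H.γ₁_lip.continuousOn.continuousAt hI).comp continuousAt_snd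
  have c2 : ContinuousAt (fun q : ℝ × ℝ => γ₂ q.2) p :=
    (H.γ₂_lip.continuousOn.continuousAt hI).comp continuousAt_snd
  filter_upwards [continuousAt_snd.preimage_mem_nhds (Ioo_mem_nhds h0.1 h0.2),
    c1.eventually_lt continuousAt_fst h1, continuousAt_fst.eventually_lt c2 h2] with q q0 q1 q2
  exact ⟨q0, q1, q2⟩

lemma volume_lensD_ne_top (H : SmallRuling tb γ₁ γ₂ φ₁ φ₂ lam Mγ Lγ Mφ Lφ) :
    volume (lensD γ₁ γ₂ tb) ≠ ⊤ := by
  have hsub : lensD γ₁ γ₂ tb ⊆ Icc (-(Mγ : ℝ)) Mγ ×ˢ Icc 0 tb := by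
    rintro p ⟨h0, h1, h2⟩
    have hI := Ioo_subset_Icc_self h0
    have b1 := abs_le.1 (H.γ₁_bd _ hI)
    have b2 := abs_le.1 (H.γ₂_bd _ hI)
    exact ⟨⟨by linarith, by linarith⟩, hI⟩
  exact ((measure_mono hsub).trans_lt (isCompact_Icc.prod isCompact_Icc).measure_lt_top).ne

end SmallRuling

namespace SmallRuling

variable {tb : ℝ} {γ₁ γ₂ φ₁ φ₂ lam : ℝ → ℝ} {Mγ Lγ Mφ Lφ : NNReal} {u : ℝ × ℝ → ℝ}

/-- Every point of the lens lies on the projection of a ruling. -/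
lemma exists_rulingTau_eq (H : SmallRuling tb γ₁ γ₂ φ₁ φ₂ lam Mγ Lγ Mφ Lφ)
    (hu : heisRho γ₁ γ₂ φ₁ φ₂ lam '' (Ioo (0 : ℝ) 1 ×ˢ Ioo (0 : ℝ) tb)
      = (fun w : ℝ × ℝ => (u w, w.1, w.2 + 2 * w.1 * u w)) '' lensD γ₁ γ₂ tb)
    {p : ℝ × ℝ} (hp : p ∈ lensD γ₁ γ₂ tb) :
    ∃ s ∈ Ioo 0 tb, p.1 ∈ Ioo (γ₁ s) (γ₂ (lam s)) ∧ rulingTau γ₁ γ₂ φ₁ φ₂ lam p.1 s = p.2 ∧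
      rulingVal γ₁ γ₂ φ₁ φ₂ lam p.1 s = u p := by
  obtain ⟨⟨h, s⟩, ⟨hh, hs⟩, heq⟩ := hu.symm.subset (mem_image_of_mem _ hp)
  simp only at hh hs
  simp only [heisRho, heisP, Prod.smul_mk, Prod.mk_add_mk, smul_eq_mul, Prod.mk.injEq] at heq
  obtain ⟨e1, e2, e3⟩ := heq
  have hl := H.gap_pos hs
  have q := H.sol s (Ioo_subset_Icc_self hs)
  simp only [Qphi] at q
  have hY : (p.1 - γ₁ s) / (γ₂ (lam s) - γ₁ s) = h := by
    rw [div_eq_iff hl.ne']; linear_combination -e2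
  have hV : rulingVal γ₁ γ₂ φ₁ φ₂ lam p.1 s = u p := by
    rw [rulingVal, hY]; linear_combination e1
  refine ⟨s, hs, ⟨?_, ?_⟩, ?_, hV⟩
  · nlinarith [mul_pos hh.1 hl]
  · nlinarith [mul_pos (sub_pos.2 hh.2) hl]
  · rw [rulingTau, hV]
    have e3' : p.2 = (1 - h) * (s + 2 * γ₁ s * φ₁ s) + h * (lam s + 2 * γ₂ (lam s) * φ₂ (lam s))
      - 2 * p.1 * u p := by linarith
    rw [e3', ← e1, ← e2]
    linear_combination (-h) * q

/-- The projections of the rulings stay in the lens, and `u` is affine along them. -/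
lemma mk_rulingTau_mem (H : SmallRuling tb γ₁ γ₂ φ₁ φ₂ lam Mγ Lγ Mφ Lφ)
    (hu : heisRho γ₁ γ₂ φ₁ φ₂ lam '' (Ioo (0 : ℝ) 1 ×ˢ Ioo (0 : ℝ) tb)
      = (fun w : ℝ × ℝ => (u w, w.1, w.2 + 2 * w.1 * u w)) '' lensD γ₁ γ₂ tb)
    {y s : ℝ} (hs : s ∈ Ioo 0 tb) (hy : y ∈ Ioo (γ₁ s) (γ₂ (lam s))) :
    (y, rulingTau γ₁ γ₂ φ₁ φ₂ lam y s) ∈ lensD γ₁ γ₂ tb := by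
  have hl := H.gap_pos hs
  have q := H.sol s (Ioo_subset_Icc_self hs)
  simp only [Qphi] at q
  obtain ⟨h, hh⟩ : ∃ h, h = (y - γ₁ s) / (γ₂ (lam s) - γ₁ s) := ⟨_, rfl⟩
  have h0 : 0 < h := by rw [hh]; exact div_pos (by linarith [hy.1]) hl
  have h1 : h < 1 := by rw [hh, div_lt_one hl]; linarith [hy.2]
  obtain ⟨p, hp, heq⟩ := hu.subset (mem_image_of_mem _ (show (h, s) ∈ Ioo (0 : ℝ) 1 ×ˢ Ioo (0 : ℝ) tb from ⟨⟨h0, h1⟩, hs⟩))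
  simp only [heisRho, heisP, Prod.smul_mk, Prod.mk_add_mk, smul_eq_mul, Prod.mk.injEq] at heq
  obtain ⟨e1, e2, e3⟩ := heq
  have hyh : y = γ₁ s + h * (γ₂ (lam s) - γ₁ s) := by rw [hh]; field_simp; ring
  have hp1 : p.1 = y := by rw [e2, hyh]; ring
  have hp2 : p.2 = rulingTau γ₁ γ₂ φ₁ φ₂ lam y s := by
    rw [rulingTau, rulingVal, ← hh]
    have e3' : p.2 = (1 - h) * (s + 2 * γ₁ s * φ₁ s) + h * (lam s + 2 * γ₂ (lam s) * φ₂ (lam s))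
      - 2 * p.1 * u p := by linarith
    rw [e3', e1, hp1, hyh]
    linear_combination h * q
  rw [← hp1, ← hp2] at *
  exact hp

lemma exists_riccati (H : SmallRuling tb γ₁ γ₂ φ₁ φ₂ lam Mγ Lγ Mφ Lφ)
    (hu : heisRho γ₁ γ₂ φ₁ φ₂ lam '' (Ioo (0 : ℝ) 1 ×ˢ Ioo (0 : ℝ) tb)
      = (fun w : ℝ × ℝ => (u w, w.1, w.2 + 2 * w.1 * u w)) '' lensD γ₁ γ₂ tb) :
    ∃ b ψ : ℝ × ℝ → ℝ, LocallyLipschitzOn (lensD γ₁ γ₂ tb) b ∧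
      LocallyLipschitzOn (lensD γ₁ γ₂ tb) ψ ∧ ∀ᵐ p ∂(volume.restrict (lensD γ₁ γ₂ tb)),
        fderiv ℝ u p (1, 0) - 4 * u p * fderiv ℝ u p (0, 1) = b p ∧
        fderiv ℝ b p (1, 0) = 4 * u p * fderiv ℝ b p (0, 1) ∧
        0 < 4 * fderiv ℝ b p (0, 1) - (fderiv ℝ ψ p (1, 0) - 4 * u p * fderiv ℝ ψ p (0, 1))
          - 4 * fderiv ℝ u p (0, 1) * ψ p - ψ p ^ 2 := by
  have hex : ∀ p : ℝ × ℝ, ∃ s, p ∈ lensD γ₁ γ₂ tb → s ∈ Ioo 0 tb ∧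
      p.1 ∈ Ioo (γ₁ s) (γ₂ (lam s)) ∧ rulingTau γ₁ γ₂ φ₁ φ₂ lam p.1 s = p.2 ∧
      rulingVal γ₁ γ₂ φ₁ φ₂ lam p.1 s = u p := fun p => by
    by_cases hp : p ∈ lensD γ₁ γ₂ tb
    · obtain ⟨s, h⟩ := H.exists_rulingTau_eq hu hp
      exact ⟨s, fun _ => h⟩
    · exact ⟨0, fun h => absurd h hp⟩
  choose S hS using hex
  have hSI : ∀ p ∈ lensD γ₁ γ₂ tb, S p ∈ Icc 0 tb := fun p hp => Ioo_subset_Icc_self (hS p hp).1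
  have hlamI : ∀ p ∈ lensD γ₁ γ₂ tb, lam (S p) ∈ Icc 0 tb := fun p hp => H.mapsTo (hSI p hp)
  -- `S` is Lipschitz in the vertical direction
  have hvert : ∀ p ∈ lensD γ₁ γ₂ tb, ∀ t, (p.1, t) ∈ lensD γ₁ γ₂ tb →
      |S (p.1, t) - S p| ≤ 4 / 3 * |t - p.2| := fun p hp t ht => by
    have h := H.abs_sub_le_of_rulingTau (hSI p hp) (hSI _ ht) (hS p hp).2.1 (hS _ ht).2.1
    rwa [(hS p hp).2.2.1, (hS _ ht).2.2.1] at h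
  -- `S` is constant along the rulings
  have hconst : ∀ p ∈ lensD γ₁ γ₂ tb, ∀ y ∈ Ioo (γ₁ (S p)) (γ₂ (lam (S p))),
      S (y, rulingTau γ₁ γ₂ φ₁ φ₂ lam y (S p)) = S p := fun p hp y hy => by
    have hm := H.mk_rulingTau_mem hu (hS p hp).1 hy
    have h := H.abs_sub_le_of_rulingTau (hSI p hp) (hSI _ hm) hy (hS _ hm).2.1
    rw [(hS _ hm).2.2.1, sub_self, abs_zero, mul_zero] at h
    exact sub_eq_zero.1 (abs_nonpos_iff.1 h)
  have hnear : ∀ p ∈ lensD γ₁ γ₂ tb, ∀ p' ∈ lensD γ₁ γ₂ tb,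
      p'.1 ∈ Ioo (γ₁ (S p)) (γ₂ (lam (S p))) →
      |S p' - S p| ≤ 4 / 3 * (1 + 4 * Mφ) * dist p' p := fun p hp p' hp' hy => by
    have h1 := H.abs_sub_le_of_rulingTau (hSI p hp) (hSI p' hp') hy (hS p' hp').2.1
    have h2 := H.abs_rulingTau_sub_le (hSI p hp) (hS p hp).2.1 hy
    rw [(hS p hp).2.2.1] at h2
    rw [(hS p' hp').2.2.1] at h1
    have h3 : |p'.2 - rulingTau γ₁ γ₂ φ₁ φ₂ lam p'.1 (S p)| ≤ |p'.2 - p.2|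
        + |rulingTau γ₁ γ₂ φ₁ φ₂ lam p'.1 (S p) - p.2| := by
      rw [abs_sub_comm (rulingTau γ₁ γ₂ φ₁ φ₂ lam p'.1 (S p))]; exact abs_sub_le _ _ _
    have h4 : |p'.2 - p.2| ≤ dist p' p := le_max_right _ _
    have h5 : |p'.1 - p.1| ≤ dist p' p := le_max_left _ _
    have h6 : 4 * Mφ * |p'.1 - p.1| ≤ 4 * Mφ * dist p' p := by gcongr
    linarith
  have hSL : LocallyLipschitzOn (lensD γ₁ γ₂ tb) S := by
    intro p hp
    rw [H.isOpen_lensD.nhdsWithin_eq hp]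
    have hI : Icc 0 tb ∈ 𝓝 p.2 := Icc_mem_nhds hp.1.1 hp.1.2
    have c1 : ContinuousAt (fun q : ℝ × ℝ => q.1 - γ₁ q.2) p :=
      continuousAt_fst.sub ((H.γ₁_lip.continuousOn.continuousAt hI).comp continuousAt_snd)
    have c2 : ContinuousAt (fun q : ℝ × ℝ => γ₂ q.2 - q.1) p :=
      ((H.γ₂_lip.continuousOn.continuousAt hI).comp continuousAt_snd).sub continuousAt_fst
    obtain ⟨d, hd0, hd⟩ := exists_between
      (lt_min (sub_pos.2 hp.2.1) (sub_pos.2 hp.2.2))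
    rw [lt_min_iff] at hd
    refine ⟨Real.toNNReal (4 / 3 * (1 + 4 * Mφ)),
      {q | q ∈ lensD γ₁ γ₂ tb ∧ d < q.1 - γ₁ q.2 ∧ d < γ₂ q.2 - q.1 ∧ dist q p < d / 4}, ?_, ?_⟩
    · filter_upwards [H.isOpen_lensD.mem_nhds hp, c1.eventually_const_lt hd.1,
        c2.eventually_const_lt hd.2, Metric.ball_mem_nhds p (by positivity : 0 < d / 4)]
        with q q0 q1 q2 q3
      exact ⟨q0, q1, q2, q3⟩
    · apply LipschitzOnWith.of_dist_le_mul
      rintro q' ⟨m', -, -, n'⟩ q ⟨m, n1, n2, n⟩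
      rw [Real.coe_toNNReal _ (by positivity), Real.dist_eq]
      refine hnear q m q' m' ?_
      have h1 := H.le_sub_left (hSI q m) (Ioo_subset_Icc_self m.1) (hS q m).2.1 (hS q m).2.2.1
      have h2 := H.le_sub_right (hSI q m) (Ioo_subset_Icc_self m.1) (hS q m).2.1 (hS q m).2.2.1
      have h3 : |q'.1 - q.1| ≤ dist q' q := le_max_left _ _
      have h4 := dist_triangle_right q' q p
      have h5 := abs_le.1 h3
      constructor <;> linarith [h5.1, h5.2]
  have hcomp : ∀ {k : ℝ → ℝ} {K : NNReal}, LipschitzOnWith K k (Icc 0 tb) →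
      LocallyLipschitzOn (lensD γ₁ γ₂ tb) fun p => k (S p) := fun {k K} hk p hp => by
    obtain ⟨C, t, ht, hC⟩ := hSL hp
    exact ⟨K * C, t ∩ lensD γ₁ γ₂ tb, inter_mem ht self_mem_nhdsWithin,
      hk.comp (hC.mono inter_subset_left) fun q hq => hSI q hq.2⟩
  have hlamL : LipschitzOnWith (11 / 10) lam (Icc 0 tb) :=
    LipschitzOnWith.of_dist_le_mul fun s hs s' hs' => by
      simpa [Real.dist_eq] using H.abs_lam_sub_le hs' hs
  have hcompv : ∀ {k : ℝ → ℝ} {K : NNReal}, LipschitzOnWith K k (Icc 0 tb) →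
      ∀ p ∈ lensD γ₁ γ₂ tb, ∀ t, (p.1, t) ∈ lensD γ₁ γ₂ tb →
      |k (S (p.1, t)) - k (S p)| ≤ 3 / 2 * K * |t - p.2| ∧
      |k (lam (S (p.1, t))) - k (lam (S p))| ≤ 3 / 2 * K * |t - p.2| := fun {k K} hk p hp t ht => by
    have h1 := hk.abs_sub_le (hSI _ ht) (hSI p hp)
    have h2 := hk.abs_sub_le (hlamI _ ht) (hlamI p hp)
    have h3 := H.abs_lam_sub_le (hSI p hp) (hSI _ ht)
    have h4 := hvert p hp t ht
    have h5 : (0 : ℝ) ≤ K := K.2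
    have h6 : 0 ≤ |t - p.2| := abs_nonneg _
    have h7 : |lam (S (p.1, t)) - lam (S p)| ≤ 3 / 2 * |t - p.2| := by linarith
    have h8 : |S (p.1, t) - S p| ≤ 3 / 2 * |t - p.2| := by linarith
    constructor
    · refine h1.trans ?_
      rw [mul_right_comm, mul_comm]
      gcongr
    · refine h2.trans ?_
      rw [mul_right_comm, mul_comm]
      gcongr
  refine exists_riccati_of_ruling H.isOpen_lensD (Mg := Mγ) (Mf := Mφ) (Cg := 3 / 2 * Lγ)
    (Cf := 3 / 2 * Lφ) (by linarith [H.small]) (by positivity) (by positivity)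
    (hcomp H.γ₁_lip) (hcomp (H.γ₂_lip.comp hlamL H.mapsTo)) (hcomp H.φ₁_lip)
    (hcomp (H.φ₂_lip.comp hlamL H.mapsTo))
    (fun p hp => (hS p hp).2.1) (fun p hp => ⟨H.γ₁_bd _ (hSI p hp), H.γ₂_bd _ (hlamI p hp)⟩)
    (fun p hp => ⟨H.φ₁_bd _ (hSI p hp), H.φ₂_bd _ (hlamI p hp)⟩) ?_ ?_ ?_
  · intro p hp
    have hl := H.gap_pos (hS p hp).1
    rw [← (hS p hp).2.2.2]
    simp only [rulingVal, Function.comp_apply]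
    field_simp
    ring
  · intro p hp
    refine ⟨fun y => rulingTau γ₁ γ₂ φ₁ φ₂ lam y (S p), (hS p hp).2.2.1, ?_, ?_⟩
    · rw [← (hS p hp).2.2.2]
      exact hasDerivAt_rulingTau _ _
    · filter_upwards [Ioo_mem_nhds (hS p hp).2.1.1 (hS p hp).2.1.2] with y hy
      simp only [hconst p hp y hy, and_self]
  · intro p hp
    have hev : ∀ᶠ t in 𝓝 p.2, (p.1, t) ∈ lensD γ₁ γ₂ tb :=
      (continuous_const.prodMk continuous_id).continuousAt.preimage_mem_nhds
        (H.isOpen_lensD.mem_nhds hp)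
    filter_upwards [hev] with t ht
    exact ⟨(hcompv H.γ₁_lip p hp t ht).1, (hcompv H.γ₂_lip p hp t ht).2,
      (hcompv H.φ₁_lip p hp t ht).1, (hcompv H.φ₂_lip p hp t ht).2⟩

end SmallRuling

lemma mul_add_mul_le_of_lt_sqrt {M L m l z : ℝ} (hM : 0 ≤ M) (hL : 0 ≤ L) (hm : 0 ≤ m)
    (hl : 0 ≤ l) (hz : z = 4 * (M + L) * (m + l)) (h : z < (√721 - 25) / 48) :
    100 * (M * l + m * L) ≤ 1 := by
  have h1 : √721 < 26.92 := by
    rw [Real.sqrt_lt' (by norm_num)]; norm_num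
  have h2 : 0 ≤ M * m := mul_nonneg hM hm
  have h3 : 0 ≤ L * l := mul_nonneg hL hl
  nlinarith

end

/-- the ruled solution `u` is a stationary point of the intrinsic area:
for every `w ∈ C^∞_c(D)`, `ε ↦ A_H(u + εw)` has vanishing derivative at `ε = 0`,
and `A_H(u) ≤ A_H(u + εw)` for all small `|ε|`. -/
theorem stmt_18 (tb : ℝ) (htb : 0 < tb)
    (γ₁ γ₂ φ₁ φ₂ : ℝ → ℝ) (Mγ Lγ Mφ Lφ : NNReal)
    (hγ₁lip : LipschitzOnWith Lγ γ₁ (Set.Icc 0 tb))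
    (hγ₂lip : LipschitzOnWith Lγ γ₂ (Set.Icc 0 tb))
    (hγ₁bd : ∀ s ∈ Set.Icc 0 tb, |γ₁ s| ≤ (Mγ : ℝ))
    (hγ₂bd : ∀ s ∈ Set.Icc 0 tb, |γ₂ s| ≤ (Mγ : ℝ))
    (hφ₁lip : LipschitzOnWith Lφ φ₁ (Set.Icc 0 tb))
    (hφ₂lip : LipschitzOnWith Lφ φ₂ (Set.Icc 0 tb))
    (hφ₁bd : ∀ s ∈ Set.Icc 0 tb, |φ₁ s| ≤ (Mφ : ℝ))
    (hφ₂bd : ∀ s ∈ Set.Icc 0 tb, |φ₂ s| ≤ (Mφ : ℝ))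
    (hsign : ∀ t ∈ Set.Ioo 0 tb, γ₁ t < 0 ∧ 0 < γ₂ t)
    (hγ₁0 : γ₁ 0 = 0) (hγ₁t : γ₁ tb = 0) (hγ₂0 : γ₂ 0 = 0) (hγ₂t : γ₂ tb = 0)
    (hφ0 : φ₁ 0 = φ₂ 0) (hφt : φ₁ tb = φ₂ tb)
    (hconv : ConvexOn ℝ (Set.Icc 0 tb) γ₁)
    (hconc : ConcaveOn ℝ (Set.Icc 0 tb) γ₂)
    (zeta : ℝ) (hzdef : zeta = 4 * ((Mγ : ℝ) + (Lγ : ℝ)) * ((Mφ : ℝ) + (Lφ : ℝ)))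
    (hzeta : zeta < (Real.sqrt 721 - 25) / 48)
    (lam : ℝ → ℝ)
    (hlam_bij : Set.BijOn lam (Set.Icc 0 tb) (Set.Icc 0 tb))
    (hlam_mono : StrictMonoOn lam (Set.Icc 0 tb))
    (hlam_sol : ∀ s ∈ Set.Icc 0 tb, Qphi γ₁ γ₂ φ₁ φ₂ s (lam s) = 0)
    (hlam0 : lam 0 = 0) (hlamt : lam tb = tb)
    -- the ruled solution u
    (u : ℝ × ℝ → ℝ) (Ku : NNReal)
    (hu_lip : LipschitzOnWith Ku u (closure (lensD γ₁ γ₂ tb)))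
    (hu_graph : heisRho γ₁ γ₂ φ₁ φ₂ lam '' (Set.Ioo (0:ℝ) 1 ×ˢ Set.Ioo (0:ℝ) tb)
      = (fun w : ℝ × ℝ => (u w, w.1, w.2 + 2 * w.1 * u w)) '' lensD γ₁ γ₂ tb)
    (hu_bdry : ∀ s ∈ Set.Icc 0 tb, u (γ₁ s, s) = φ₁ s ∧ u (γ₂ s, s) = φ₂ s) :
    -- partial derivatives of u, defined a.e.
    ∃ uy ut : ℝ × ℝ → ℝ,
      (∀ᵐ w ∂(volume.restrict (lensD γ₁ γ₂ tb)),
        HasDerivAt (fun y : ℝ => u (y, w.2)) (uy w) w.1 ∧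
        HasDerivAt (fun t : ℝ => u (w.1, t)) (ut w) w.2) ∧
      -- for every test function, the area of the perturbed graph
      ∀ ww : ℝ × ℝ → ℝ, ContDiff ℝ (⊤ : ℕ∞) ww → HasCompactSupport ww →
        tsupport ww ⊆ lensD γ₁ γ₂ tb →
        HasDerivAt
          (fun ε : ℝ => ∫ w in lensD γ₁ γ₂ tb,
            Real.sqrt (1 +
              ((uy w + ε * fderiv ℝ ww w (1, 0))
                - 4 * (u w + ε * ww w) * (ut w + ε * fderiv ℝ ww w (0, 1))) ^ 2))
          0 0 ∧
        ∃ ε₀ > (0:ℝ), ∀ ε : ℝ, |ε| < ε₀ →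
          (∫ w in lensD γ₁ γ₂ tb,
            Real.sqrt (1 + (uy w - 4 * u w * ut w) ^ 2))
          ≤ ∫ w in lensD γ₁ γ₂ tb,
            Real.sqrt (1 +
              ((uy w + ε * fderiv ℝ ww w (1, 0))
                - 4 * (u w + ε * ww w) * (ut w + ε * fderiv ℝ ww w (0, 1))) ^ 2) := by
  have H : SmallRuling tb γ₁ γ₂ φ₁ φ₂ lam Mγ Lγ Mφ Lφ :=
    { γ₁_lip := hγ₁lip, γ₂_lip := hγ₂lip, φ₁_lip := hφ₁lip, φ₂_lip := hφ₂lip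
      γ₁_bd := hγ₁bd, γ₂_bd := hγ₂bd, φ₁_bd := hφ₁bd, φ₂_bd := hφ₂bd, sign := hsign
      small := mul_add_mul_le_of_lt_sqrt Mγ.2 Lγ.2 Mφ.2 Lφ.2 hzdef hzeta
      mapsTo := hlam_bij.mapsTo
      mapsTo_Ioo := fun s hs => by
        have h1 := hlam_mono (left_mem_Icc.2 htb.le) (Ioo_subset_Icc_self hs) hs.1
        have h2 := hlam_mono (Ioo_subset_Icc_self hs) (right_mem_Icc.2 htb.le) hs.2
        rw [hlam0] at h1
        rw [hlamt] at h2
        exact ⟨h1, h2⟩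
      sol := hlam_sol }
  have hD := H.isOpen_lensD
  have huD : LipschitzOnWith Ku u (lensD γ₁ γ₂ tb) := hu_lip.mono subset_closure
  have huC : ∀ p ∈ lensD γ₁ γ₂ tb, |u p| ≤ Mφ := fun p hp => by
    obtain ⟨s, hs, hy, -, hV⟩ := H.exists_rulingTau_eq hu_graph hp
    rw [← hV]
    exact H.abs_rulingVal_le (Ioo_subset_Icc_self hs) hy
  obtain ⟨b, ψ, hb, hψ, hae⟩ := H.exists_riccati hu_graph
  refine ⟨fun p => fderiv ℝ u p (1, 0), fun p => fderiv ℝ u p (0, 1), ?_, fun ww hw hwc hws =>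
    intrinsicArea_stationary_of_riccati hD H.volume_lensD_ne_top huD huC hb hψ
      (hae.mono fun _ h => h.1) (hae.mono fun _ h => h.2.1) (hae.mono fun _ h => h.2.2) hw hwc hws⟩
  filter_upwards [ae_differentiableAt_of_locallyLipschitzOn volume hD
    fun p _ => ⟨Ku, _, self_mem_nhdsWithin, huD⟩] with p hp
  exact ⟨(hp.hasFDerivAt (x := (p.1, p.2))).comp_hasDerivAt p.1
      ((hasDerivAt_id' _).prodMk (hasDerivAt_const _ _)),
    (hp.hasFDerivAt (x := (p.1, p.2))).comp_hasDerivAt p.2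
      ((hasDerivAt_const _ _).prodMk (hasDerivAt_id' _))⟩
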